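/- arXiv:1512.06640 — 3 statements merged into one kernel-verified Lean document; each statement's English description precedes it below -/
import Mathlib

section
/- Let μ ∈ M, ε > 0 and m ∈ ℝ, and let ν₁, ν₂ ∈ B∞(μ,ε) ∩ M_m. Then the measure ν₁ ∨ ν₂ whose call function is the pointwise maximum R_{ν₁} ∨ R_{ν₂}, and the measure ν₁ ∧ ν₂ whose call function is the convex hull conv(R_{ν₁}, R_{ν₂}) (the largest convex function majorized by min(R_{ν₁}, R_{ν₂})), both belong to B∞(μ,ε) ∩ M_m. In particular, ν₁ ∨ ν₂ is the supremum and ν₁ ∧ ν₂ is the infimum of {ν₁, ν₂} in the lattice (M_m, ≤_c). -/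
open MeasureTheory Filter Set
open scoped ENNReal

/-- Call function `R_μ(x) = ∫ (y−x)⁺ μ(dy)`. -/
noncomputable def callFn (μ : Measure ℝ) (x : ℝ) : ℝ := ∫ y, max (y - x) 0 ∂μ

/-- Mean `Eμ = ∫ y μ(dy)`. -/
noncomputable def meanM (μ : Measure ℝ) : ℝ := ∫ y, y ∂μ

/-- Distribution function `F_μ(x) = μ((−∞,x])`. -/
noncomputable def cdfM (μ : Measure ℝ) (x : ℝ) : ℝ := (μ (Set.Iic x)).toReal

/-- Membership in `M`: Borel probability measure on ℝ with finite first moment. -/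
def MemM (μ : Measure ℝ) : Prop :=
  IsProbabilityMeasure μ ∧ Integrable (fun y => y) μ

/-- Convex order `μ ≤_c ν`. -/
def ConvexOrder (μ ν : Measure ℝ) : Prop :=
  ∀ φ : ℝ → ℝ, ConvexOn ℝ Set.univ φ → Integrable φ μ → Integrable φ ν →
    ∫ y, φ y ∂μ ≤ ∫ y, φ y ∂ν

/-- Infinity Wasserstein distance via distribution functions, valued in `[0,∞]`,
with `inf ∅ = ∞`. -/
noncomputable def Winf (μ ν : Measure ℝ) : ℝ≥0∞ :=
  sInf (ENNReal.ofReal '' {ε : ℝ | 0 < ε ∧ ∀ x : ℝ,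
    cdfM μ (x - ε) ≤ cdfM ν x ∧ cdfM ν x ≤ cdfM μ (x + ε)})

/-- Membership in the closed ball `B^∞(μ,ε)` (within `M`). -/
def InBallWinf (μ : Measure ℝ) (ε : ℝ) (ν : Measure ℝ) : Prop :=
  MemM ν ∧ Winf μ ν ≤ ENNReal.ofReal ε

/-- `conv2 f g`: the largest convex function majorized by `min f g`, pointwise. -/
noncomputable def conv2 (f g : ℝ → ℝ) (x : ℝ) : ℝ :=
  sSup {z : ℝ | ∃ h : ℝ → ℝ, ConvexOn ℝ Set.univ h ∧ (∀ y, h y ≤ min (f y) (g y)) ∧ z = h x}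

/-- `R^min_μ(x; m, ε)`. -/
noncomputable def RminW (μ : Measure ℝ) (m ε x : ℝ) : ℝ :=
  max (m + callFn μ (x - ε) - (meanM μ + ε)) (callFn μ (x + ε))

/-- `R^max_μ(x; m, ε)`. -/
noncomputable def RmaxW (μ : Measure ℝ) (m ε x : ℝ) : ℝ :=
  conv2 (fun y => m + callFn μ (y + ε) - (meanM μ - ε)) (fun y => callFn μ (y - ε)) x

/-- Right derivative. -/
noncomputable def rderiv (f : ℝ → ℝ) (x : ℝ) : ℝ := derivWithin f (Set.Ioi x) x

/-- `R` is a call function: convex, nonincreasing, tending to `0` at `+∞`, and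
`R(x)+x` has a finite limit at `−∞`. -/
def IsCallFn (R : ℝ → ℝ) : Prop :=
  ConvexOn ℝ Set.univ R ∧ Antitone R ∧
    Tendsto R atTop (nhds 0) ∧ ∃ c : ℝ, Tendsto (fun x => R x + x) atBot (nhds c)

/-- Stop-loss distance, valued in `[0,∞]`. -/
noncomputable def dSL (μ ν : Measure ℝ) : ℝ≥0∞ :=
  ⨆ x : ℝ, ENNReal.ofReal |callFn μ x - callFn ν x|

/-- Lévy distance. -/
noncomputable def dLevy (μ ν : Measure ℝ) : ℝ≥0∞ :=
  sInf (ENNReal.ofReal '' {h : ℝ | 0 < h ∧ ∀ x : ℝ,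
    cdfM μ (x - h) - h ≤ cdfM ν x ∧ cdfM ν x ≤ cdfM μ (x + h) + h})

/-- Prokhorov distance on ℝ. -/
noncomputable def dProk (μ ν : Measure ℝ) : ℝ≥0∞ :=
  sInf (ENNReal.ofReal '' {h : ℝ | 0 < h ∧ ∀ A : Set ℝ, IsClosed A →
    ν A ≤ μ (Metric.cthickening h A) + ENNReal.ofReal h})

/-- Modified Lévy distance with parameter `p`. -/
noncomputable def dLevyMod (p : ℝ) (μ ν : Measure ℝ) : ℝ≥0∞ :=
  sInf (ENNReal.ofReal '' {h : ℝ | 0 < h ∧ ∀ x : ℝ,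
    cdfM μ (x - h) - p ≤ cdfM ν x ∧ cdfM ν x ≤ cdfM μ (x + h) + p})

/-- Modified Prokhorov distance with parameter `p`. -/
noncomputable def dProkMod (p : ℝ) (μ ν : Measure ℝ) : ℝ≥0∞ :=
  sInf (ENNReal.ofReal '' {h : ℝ | 0 < h ∧ ∀ A : Set ℝ, IsClosed A →
    ν A ≤ μ (Metric.cthickening h A) + ENNReal.ofReal p})
/-! ### Convex functions and Stieltjes functions -/

lemma convex_exists_stieltjes (f : ℝ → ℝ) (hf : ConvexOn ℝ univ f) :
    ∃ G : StieltjesFunction ℝ, (∀ x, HasDerivWithinAt f (G x) (Ioi x) x) ∧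
      (∀ x z, f x + G x * (z - x) ≤ f z) := by
  have hcont : Continuous f := by
    have := hf.continuousOn isOpen_univ
    exact continuousOn_univ.mp this
  set r : ℝ → ℝ := fun x => derivWithin f (Ioi x) x with hr
  have hd : ∀ x, HasDerivWithinAt f (r x) (Ioi x) x := fun x =>
    hf.hasDerivWithinAt_rightDeriv_of_mem_interior (by simp)
  have hright : ∀ x z, x < z → r x ≤ (f z - f x) / (z - x) := by
    intro x z hxz
    have := hf.le_slope_of_hasDerivWithinAt_Ioi (mem_univ x) (mem_univ z) hxz (hd x)
    rwa [slope_def_field] at this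
  have hleft : ∀ x z, z < x → (f x - f z) / (x - z) ≤ r x := by
    intro x z hzx
    refine ge_of_tendsto ((hasDerivWithinAt_iff_tendsto_slope' self_notMem_Ioi).mp (hd x)) ?_
    filter_upwards [self_mem_nhdsWithin] with w hw
    rw [slope_def_field]
    exact hf.slope_mono_adjacent (mem_univ z) (mem_univ w) hzx hw
  have hmono : Monotone r := by
    intro x z hxz
    rcases hxz.eq_or_lt with rfl | h
    · rfl
    · exact (hright x z h).trans (hleft z x h)
  have hrc : ∀ x, ContinuousWithinAt r (Ici x) x := by
    intro x
    rw [← continuousWithinAt_Ioi_iff_Ici]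
    refine tendsto_order.2 ⟨?_, ?_⟩
    · intro a ha
      filter_upwards [self_mem_nhdsWithin] with w hw
      exact ha.trans_le (hmono (le_of_lt hw))
    · intro a ha
      have h1 := (hasDerivWithinAt_iff_tendsto_slope' self_notMem_Ioi).mp (hd x)
      obtain ⟨w, hw, hxw⟩ := ((h1.eventually_lt_const ha).and self_mem_nhdsWithin).exists
      have hxw' : x < w := hxw
      rw [slope_def_field] at hw
      have h2 : Tendsto (fun z => (f w - f z) / (w - z)) (nhdsWithin x (Ioi x))
          (nhds ((f w - f x) / (w - x))) := by
        refine Tendsto.mono_left ?_ nhdsWithin_le_nhds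
        refine Tendsto.div ?_ ?_ (by linarith)
        · exact tendsto_const_nhds.sub (hcont.tendsto x)
        · exact tendsto_const_nhds.sub tendsto_id
      filter_upwards [h2.eventually_lt_const hw, Ioo_mem_nhdsGT hxw'] with z hz hz2
      exact (hright z w hz2.2).trans_lt hz
  refine ⟨⟨r, hmono, hrc⟩, hd, ?_⟩
  intro x z
  change f x + r x * (z - x) ≤ f z
  rcases lt_trichotomy x z with h | h | h
  · have := hright x z h
    rw [le_div_iff₀ (by linarith)] at this
    linarith
  · subst h; simp
  · have := hleft x z h
    rw [div_le_iff₀ (by linarith)] at this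
    linarith

lemma stieltjes_ftc (f : ℝ → ℝ) (hf : ConvexOn ℝ univ f) (G : StieltjesFunction ℝ)
    (hG : ∀ x, HasDerivWithinAt f (G x) (Ioi x) x) (a b : ℝ) :
    ∫ y in a..b, G y = f b - f a := by
  have hcont : Continuous f := continuousOn_univ.mp (hf.continuousOn isOpen_univ)
  exact intervalIntegral.integral_eq_sub_of_hasDeriv_right hcont.continuousOn
    (fun x _ => hG x) (G.mono.intervalIntegrable)

/-! ### Layer cake -/

lemma layer_right (γ : Measure ℝ) [SFinite γ] (x : ℝ) :
    ∫⁻ t, ENNReal.ofReal (t - x) ∂γ = ∫⁻ s in Ioi x, γ (Ici s) := by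
  have h1 : ∀ t, ENNReal.ofReal (t - x) = ∫⁻ s in Ioi x, (Iic t).indicator 1 s := by
    intro t
    rw [lintegral_indicator_one measurableSet_Iic, Measure.restrict_apply measurableSet_Iic,
      inter_comm, Ioi_inter_Iic, Real.volume_Ioc]
  have h2 : ∀ s, γ (Ici s) = ∫⁻ t, (Iic t).indicator 1 s ∂γ := by
    intro s
    rw [← lintegral_indicator_one measurableSet_Ici]
    rfl
  simp_rw [h1, h2]
  rw [lintegral_lintegral_swap]
  have : Measurable (fun p : ℝ × ℝ => ({p : ℝ × ℝ | p.2 ≤ p.1}).indicator (1 : ℝ × ℝ → ℝ≥0∞) p) :=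
    measurable_one.indicator (measurableSet_le measurable_snd measurable_fst)
  exact this.aemeasurable

lemma layer_left (γ : Measure ℝ) [SFinite γ] (x : ℝ) :
    ∫⁻ t, ENNReal.ofReal (x - t) ∂γ = ∫⁻ s in Iic x, γ (Iic s) := by
  have h1 : ∀ t, ENNReal.ofReal (x - t) = ∫⁻ s in Iic x, (Ici t).indicator 1 s := by
    intro t
    rw [lintegral_indicator_one measurableSet_Ici, Measure.restrict_apply measurableSet_Ici,
      Ici_inter_Iic, Real.volume_Icc]
  have h2 : ∀ s, γ (Iic s) = ∫⁻ t, (Ici t).indicator 1 s ∂γ := by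
    intro s
    rw [← lintegral_indicator_one measurableSet_Iic]
    rfl
  simp_rw [h1, h2]
  rw [lintegral_lintegral_swap]
  have : Measurable (fun p : ℝ × ℝ => ({p : ℝ × ℝ | p.1 ≤ p.2}).indicator (1 : ℝ × ℝ → ℝ≥0∞) p) :=
    measurable_one.indicator (measurableSet_le measurable_fst measurable_snd)
  exact this.aemeasurable

/-! ### Taylor formulas -/

lemma layer_right' (γ : Measure ℝ) [SFinite γ] (x : ℝ) :
    ∫⁻ t, ENNReal.ofReal (t - x) ∂γ = ∫⁻ s in Ioi x, γ (Ioi s) := by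
  have h1 : ∀ t, ENNReal.ofReal (t - x) = ∫⁻ s in Ioi x, (Iio t).indicator 1 s := by
    intro t
    rw [lintegral_indicator_one measurableSet_Iio, Measure.restrict_apply measurableSet_Iio,
      inter_comm, Ioi_inter_Iio, Real.volume_Ioo]
  have h2 : ∀ s, γ (Ioi s) = ∫⁻ t, (Iio t).indicator 1 s ∂γ := by
    intro s
    rw [← lintegral_indicator_one measurableSet_Ioi]
    rfl
  simp_rw [h1, h2]
  rw [lintegral_lintegral_swap]
  have : Measurable (fun p : ℝ × ℝ => ({p : ℝ × ℝ | p.2 < p.1}).indicator (1 : ℝ × ℝ → ℝ≥0∞) p) :=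
    measurable_one.indicator (measurableSet_lt measurable_snd measurable_fst)
  exact this.aemeasurable

lemma taylor_right (f : ℝ → ℝ) (hf : ConvexOn ℝ univ f) (G : StieltjesFunction ℝ)
    (hG : ∀ x, HasDerivWithinAt f (G x) (Ioi x) x) (a b : ℝ) (hab : a ≤ b) :
    ∫⁻ t in Ioc a b, ENNReal.ofReal (b - t) ∂G.measure
      = ENNReal.ofReal (f b - f a - G a * (b - a)) := by
  rw [layer_left]
  have h1 : ∫⁻ s in Iic b, (G.measure.restrict (Ioc a b)) (Iic s)
      = ∫⁻ s in Ioc a b, ENNReal.ofReal (G s - G a) := by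
    rw [← lintegral_indicator measurableSet_Iic, ← lintegral_indicator measurableSet_Ioc]
    congr 1
    ext s
    by_cases hs : s ≤ b
    · rw [indicator_of_mem (by exact hs), Measure.restrict_apply measurableSet_Iic, inter_comm,
        Ioc_inter_Iic, min_eq_right hs, G.measure_Ioc]
      by_cases hs2 : a < s
      · rw [indicator_of_mem (by exact ⟨hs2, hs⟩)]
      · rw [indicator_of_notMem (fun h => hs2 h.1)]
        exact ENNReal.ofReal_of_nonpos (by linarith [G.mono (not_lt.1 hs2)])
    · rw [indicator_of_notMem (by exact hs), indicator_of_notMem (fun h => hs h.2)]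
  rw [h1, ← ofReal_integral_eq_lintegral_ofReal]
  · rw [← intervalIntegral.integral_of_le hab, intervalIntegral.integral_sub
      G.mono.intervalIntegrable (by simp), stieltjes_ftc f hf G hG]
    simp [mul_comm]
  · rw [← IntegrableOn, ← intervalIntegrable_iff_integrableOn_Ioc_of_le hab]
    exact G.mono.intervalIntegrable.sub (by simp)
  · refine (ae_restrict_iff' measurableSet_Ioc).2 (ae_of_all _ fun s hs => ?_)
    have := G.mono hs.1.le
    simp only [Pi.zero_apply]; linarith

lemma taylor_left (f : ℝ → ℝ) (hf : ConvexOn ℝ univ f) (G : StieltjesFunction ℝ)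
    (hG : ∀ x, HasDerivWithinAt f (G x) (Ioi x) x) (a b : ℝ) (hab : a ≤ b) :
    ∫⁻ t in Ioc a b, ENNReal.ofReal (t - a) ∂G.measure
      = ENNReal.ofReal (f a - f b + G b * (b - a)) := by
  rw [layer_right']
  have h1 : ∫⁻ s in Ioi a, (G.measure.restrict (Ioc a b)) (Ioi s)
      = ∫⁻ s in Ioc a b, ENNReal.ofReal (G b - G s) := by
    rw [← lintegral_indicator measurableSet_Ioi, ← lintegral_indicator measurableSet_Ioc]
    congr 1
    ext s
    by_cases hs : a < s
    · rw [indicator_of_mem (by exact hs), Measure.restrict_apply measurableSet_Ioi, inter_comm,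
        Ioc_inter_Ioi, max_eq_right hs.le, G.measure_Ioc]
      by_cases hs2 : s ≤ b
      · rw [indicator_of_mem (by exact ⟨hs, hs2⟩)]
      · rw [indicator_of_notMem (fun h => hs2 h.2)]
        exact ENNReal.ofReal_of_nonpos (by linarith [G.mono (not_le.1 hs2).le])
    · rw [indicator_of_notMem (by exact hs), indicator_of_notMem (fun h => hs h.1)]
  rw [h1, ← ofReal_integral_eq_lintegral_ofReal]
  · rw [← intervalIntegral.integral_of_le hab, intervalIntegral.integral_sub (by simp)
      G.mono.intervalIntegrable, stieltjes_ftc f hf G hG]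
    simp only [intervalIntegral.integral_const, smul_eq_mul]
    congr 1; ring
  · rw [← IntegrableOn, ← intervalIntegrable_iff_integrableOn_Ioc_of_le hab]
    exact IntervalIntegrable.sub (by simp) G.mono.intervalIntegrable
  · refine (ae_restrict_iff' measurableSet_Ioc).2 (ae_of_all _ fun s hs => ?_)
    have := G.mono hs.2
    simp only [Pi.zero_apply]; linarith

lemma taylor_full (f : ℝ → ℝ) (hf : ConvexOn ℝ univ f) (G : StieltjesFunction ℝ)
    (hG : ∀ x, HasDerivWithinAt f (G x) (Ioi x) x) (y : ℝ) :
    ENNReal.ofReal (f y - f 0 - G 0 * y) =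
      ∫⁻ t in Ioi 0, ENNReal.ofReal (y - t) ∂G.measure
        + ∫⁻ t in Iic 0, ENNReal.ofReal (t - y) ∂G.measure := by
  have key1 : ∫⁻ t in Ioi 0, ENNReal.ofReal (y - t) ∂G.measure
      = ∫⁻ t in Ioc 0 y, ENNReal.ofReal (y - t) ∂G.measure := by
    rw [← lintegral_indicator measurableSet_Ioi, ← lintegral_indicator measurableSet_Ioc]
    congr 1
    ext s
    by_cases h0 : 0 < s
    · by_cases hs : s ≤ y
      · rw [indicator_of_mem (by exact h0), indicator_of_mem (by exact ⟨h0, hs⟩)]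
      · rw [indicator_of_mem (by exact h0), indicator_of_notMem (fun h => hs h.2)]
        exact ENNReal.ofReal_of_nonpos (by linarith)
    · rw [indicator_of_notMem (by exact h0), indicator_of_notMem (fun h => h0 h.1)]
  have key2 : ∫⁻ t in Iic 0, ENNReal.ofReal (t - y) ∂G.measure
      = ∫⁻ t in Ioc y 0, ENNReal.ofReal (t - y) ∂G.measure := by
    rw [← lintegral_indicator measurableSet_Iic, ← lintegral_indicator measurableSet_Ioc]
    congr 1
    ext s
    by_cases h0 : s ≤ 0
    · by_cases hs : y < s
      · rw [indicator_of_mem (by exact h0), indicator_of_mem (by exact ⟨hs, h0⟩)]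
      · rw [indicator_of_mem (by exact h0), indicator_of_notMem (fun h => hs h.1)]
        exact ENNReal.ofReal_of_nonpos (by linarith)
    · rw [indicator_of_notMem (by exact h0), indicator_of_notMem (fun h => h0 h.2)]
  rw [key1, key2]
  rcases le_total 0 y with h | h
  · rw [taylor_right f hf G hG 0 y h, Ioc_eq_empty (not_lt.2 h)]
    simp
  · rw [taylor_left f hf G hG y 0 h, Ioc_eq_empty (not_lt.2 h)]
    simp only [Measure.restrict_empty, lintegral_zero_measure, zero_add]
    congr 1; ring

/-! ### Call functions of measures -/

lemma integrable_call {ν : Measure ℝ} (h : MemM ν) (x : ℝ) :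
    Integrable (fun y => max (y - x) 0) ν := by
  have := h.1
  exact (h.2.sub (integrable_const x)).pos_part

lemma integrable_put {ν : Measure ℝ} (h : MemM ν) (x : ℝ) :
    Integrable (fun y => max (x - y) 0) ν := by
  have := h.1
  exact ((integrable_const x).sub h.2).pos_part

lemma call_nonneg (ν : Measure ℝ) (x : ℝ) : 0 ≤ callFn ν x :=
  integral_nonneg fun _ => le_max_right _ _

lemma put_eq {ν : Measure ℝ} (h : MemM ν) (x : ℝ) :
    ∫ y, max (x - y) 0 ∂ν = callFn ν x + x - meanM ν := by
  have := h.1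
  have h1 : ∀ y : ℝ, max (x - y) 0 = max (y - x) 0 + x - y := by
    intro y
    rcases le_total x y with h | h
    · rw [max_eq_right (by linarith), max_eq_left (by linarith)]; ring
    · rw [max_eq_left (by linarith), max_eq_right (by linarith)]; ring
  simp_rw [h1]
  have hi : Integrable (fun y => max (y - x) 0 + x) ν :=
    (integrable_call h x).add (integrable_const x)
  rw [integral_sub hi h.2, integral_add (integrable_call h x) (integrable_const x)]
  simp [callFn, meanM]

lemma lintegral_call {ν : Measure ℝ} (h : MemM ν) (x : ℝ) :
    ∫⁻ y, ENNReal.ofReal (y - x) ∂ν = ENNReal.ofReal (callFn ν x) := by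
  rw [callFn, ofReal_integral_eq_lintegral_ofReal (integrable_call h x)
    (ae_of_all _ fun _ => le_max_right _ _)]
  congr 1; ext y
  rcases le_total (y - x) 0 with h | h
  · rw [max_eq_right h, ENNReal.ofReal_of_nonpos h]; simp
  · rw [max_eq_left h]

lemma lintegral_put {ν : Measure ℝ} (h : MemM ν) (x : ℝ) :
    ∫⁻ y, ENNReal.ofReal (x - y) ∂ν = ENNReal.ofReal (callFn ν x + x - meanM ν) := by
  rw [← put_eq h, ofReal_integral_eq_lintegral_ofReal (integrable_put h x)
    (ae_of_all _ fun _ => le_max_right _ _)]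
  congr 1; ext y
  rcases le_total (x - y) 0 with h | h
  · rw [max_eq_right h, ENNReal.ofReal_of_nonpos h]; simp
  · rw [max_eq_left h]

lemma convexOn_callPayoff (x : ℝ) : ConvexOn ℝ univ (fun y : ℝ => max (y - x) 0) := by
  have h1 : ConvexOn ℝ univ (fun y : ℝ => y - x) :=
    (convexOn_id convex_univ).sub (concaveOn_const x convex_univ)
  exact h1.sup (convexOn_const 0 convex_univ)

lemma ConvexOrder.call_le {μ ν : Measure ℝ} (hμ : MemM μ) (hν : MemM ν) (h : ConvexOrder μ ν)
    (x : ℝ) : callFn μ x ≤ callFn ν x :=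
  h _ (convexOn_callPayoff x) (integrable_call hμ x) (integrable_call hν x)

lemma lintegral_convex_eq {ν : Measure ℝ} (hν : MemM ν) (φ : ℝ → ℝ) (hφ : ConvexOn ℝ univ φ)
    (G : StieltjesFunction ℝ) (hG : ∀ x, HasDerivWithinAt φ (G x) (Ioi x) x) :
    ∫⁻ y, ENNReal.ofReal (φ y - φ 0 - G 0 * y) ∂ν =
      ∫⁻ t in Ioi 0, ENNReal.ofReal (callFn ν t) ∂G.measure
        + ∫⁻ t in Iic 0, ENNReal.ofReal (callFn ν t + t - meanM ν) ∂G.measure := by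
  have := hν.1
  simp_rw [taylor_full φ hφ G hG]
  have hm1 : Measurable (fun p : ℝ × ℝ => ENNReal.ofReal (p.1 - p.2)) := by fun_prop
  have hm2 : Measurable (fun p : ℝ × ℝ => ENNReal.ofReal (p.2 - p.1)) := by fun_prop
  rw [lintegral_add_left (Measurable.lintegral_prod_right hm1)]
  congr 1
  · rw [lintegral_lintegral_swap hm1.aemeasurable]
    exact lintegral_congr fun t => lintegral_call hν t
  · rw [lintegral_lintegral_swap hm2.aemeasurable]
    exact lintegral_congr fun t => lintegral_put hν t

lemma convexOrder_of_call_le {μ ν : Measure ℝ} (hμ : MemM μ) (hν : MemM ν)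
    (hm : meanM μ = meanM ν) (h : ∀ x, callFn μ x ≤ callFn ν x) : ConvexOrder μ ν := by
  intro φ hφ hi1 hi2
  have := hμ.1
  have := hν.1
  obtain ⟨G, hG, hsub⟩ := convex_exists_stieltjes φ hφ
  have hnn : ∀ y, 0 ≤ φ y - φ 0 - G 0 * y := fun y => by
    have := hsub 0 y
    simp only [sub_zero] at this
    linarith
  have hI : ∀ {κ : Measure ℝ}, MemM κ → Integrable φ κ →
      Integrable (fun y => φ y - φ 0 - G 0 * y) κ := by
    intro κ hκ hi
    have := hκ.1
    exact (hi.sub (integrable_const _)).sub (hκ.2.const_mul _)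
  have hE : ∀ {κ : Measure ℝ}, MemM κ → Integrable φ κ →
      ∫ y, (φ y - φ 0 - G 0 * y) ∂κ = ∫ y, φ y ∂κ - φ 0 - G 0 * meanM κ := by
    intro κ hκ hi
    have := hκ.1
    have hi' : Integrable (fun y => φ y - φ 0) κ := hi.sub (integrable_const _)
    rw [integral_sub hi' (hκ.2.const_mul _),
      integral_sub hi (integrable_const _), integral_const_mul]
    simp [meanM]
  have key : ∫ y, (φ y - φ 0 - G 0 * y) ∂μ ≤ ∫ y, (φ y - φ 0 - G 0 * y) ∂ν := by
    rw [← ENNReal.ofReal_le_ofReal_iff (integral_nonneg hnn),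
      ofReal_integral_eq_lintegral_ofReal (hI hμ hi1) (ae_of_all _ hnn),
      ofReal_integral_eq_lintegral_ofReal (hI hν hi2) (ae_of_all _ hnn),
      lintegral_convex_eq hμ φ hφ G hG, lintegral_convex_eq hν φ hφ G hG, hm]
    refine add_le_add (lintegral_mono fun t => ?_) (lintegral_mono fun t => ?_)
    · exact ENNReal.ofReal_le_ofReal (h t)
    · exact ENNReal.ofReal_le_ofReal (by linarith [h t])
  rw [hE hμ hi1, hE hν hi2, hm] at key
  linarith

lemma call_subgrad {ν : Measure ℝ} (hν : MemM ν) (y z : ℝ) :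
    callFn ν y + (cdfM ν y - 1) * (z - y) ≤ callFn ν z := by
  have := hν.1
  have h1 : callFn ν y + (cdfM ν y - 1) * (z - y)
      = ∫ w, (max (w - y) 0 + ((Iic y).indicator 1 w - 1) * (z - y)) ∂ν := by
    have hi : Integrable ((Iic y).indicator (1 : ℝ → ℝ)) ν :=
      (integrable_const (1 : ℝ)).indicator measurableSet_Iic
    have hi' : Integrable (fun w => ((Iic y).indicator (1 : ℝ → ℝ) w - 1)) ν :=
      hi.sub (integrable_const _)
    rw [integral_add (integrable_call hν y) (hi'.mul_const _),
      integral_mul_const, integral_sub hi (integrable_const _), integral_indicator_one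
      measurableSet_Iic]
    simp [callFn, cdfM, Measure.real]
  rw [h1]
  refine integral_mono ?_ (integrable_call hν z) ?_
  · have hi : Integrable ((Iic y).indicator (1 : ℝ → ℝ)) ν :=
      (integrable_const (1 : ℝ)).indicator measurableSet_Iic
    exact (integrable_call hν y).add ((hi.sub (integrable_const _)).mul_const _)
  · intro w
    by_cases hw : w ≤ y
    · simp only [indicator_of_mem (show w ∈ Iic y from hw), Pi.one_apply]
      rw [max_eq_right (by linarith)]; simp
    · simp only [indicator_of_notMem (show w ∉ Iic y from hw)]
      rw [max_eq_left (by linarith)]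
      refine le_trans ?_ (le_max_left _ _)
      linarith

lemma call_tendsto_atTop {ν : Measure ℝ} (hν : MemM ν) : Tendsto (callFn ν) atTop (nhds 0) := by
  have h0 : (0 : ℝ) = ∫ _, (0 : ℝ) ∂ν := by simp
  rw [h0]
  refine tendsto_integral_filter_of_dominated_convergence (fun y => |y|) ?_ ?_ hν.2.abs ?_
  · exact Eventually.of_forall fun x => (integrable_call hν x).1
  · filter_upwards [eventually_ge_atTop 0] with x hx
    refine ae_of_all _ fun y => ?_
    rw [Real.norm_of_nonneg (le_max_right _ _)]
    exact max_le (by linarith [le_abs_self y]) (abs_nonneg y)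
  · refine ae_of_all _ fun y => ?_
    refine tendsto_const_nhds.congr' ?_
    filter_upwards [eventually_ge_atTop y] with x hx
    rw [max_eq_right (by linarith)]

lemma call_tendsto_atBot {ν : Measure ℝ} (hν : MemM ν) :
    Tendsto (fun x => callFn ν x + x) atBot (nhds (meanM ν)) := by
  have key : Tendsto (fun x => ∫ y, max (x - y) 0 ∂ν) atBot (nhds 0) := by
    have h0 : (0 : ℝ) = ∫ _, (0 : ℝ) ∂ν := by simp
    refine Eq.subst (motive := fun c => Tendsto (fun x => ∫ y, max (x - y) 0 ∂ν) atBot (nhds c))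
      h0.symm ?_
    refine tendsto_integral_filter_of_dominated_convergence (fun y => |y|) ?_ ?_ hν.2.abs ?_
    · exact Eventually.of_forall fun x => (integrable_put hν x).1
    · filter_upwards [eventually_le_atBot 0] with x hx
      refine ae_of_all _ fun y => ?_
      rw [Real.norm_of_nonneg (le_max_right _ _)]
      exact max_le (by linarith [neg_abs_le y]) (abs_nonneg y)
    · refine ae_of_all _ fun y => ?_
      refine tendsto_const_nhds.congr' ?_
      filter_upwards [eventually_le_atBot y] with x hx
      rw [max_eq_right (by linarith)]
  have h2 := key.add_const (meanM ν)
  simp_rw [put_eq hν] at h2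
  simpa using h2

lemma put_nonneg {ν : Measure ℝ} (hν : MemM ν) (x : ℝ) : 0 ≤ callFn ν x + x - meanM ν := by
  rw [← put_eq hν]
  exact integral_nonneg fun _ => le_max_right _ _

lemma call_convex {ν : Measure ℝ} (hν : MemM ν) : ConvexOn ℝ univ (callFn ν) := by
  refine ⟨convex_univ, fun x _ y _ a b ha hb hab => ?_⟩
  simp only [smul_eq_mul]
  set w := a * x + b * y with hw
  have h1 := call_subgrad hν w x
  have h2 := call_subgrad hν w y
  have h3 := mul_le_mul_of_nonneg_left h1 ha
  have h4 := mul_le_mul_of_nonneg_left h2 hb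
  have hb' : b = 1 - a := by linarith
  have : a * (callFn ν w + (cdfM ν w - 1) * (x - w)) + b * (callFn ν w + (cdfM ν w - 1) * (y - w))
      = callFn ν w := by
    have : a * (x - w) + b * (y - w) = 0 := by rw [hw, hb']; ring
    have e : a * (callFn ν w + (cdfM ν w - 1) * (x - w)) + b * (callFn ν w + (cdfM ν w - 1) * (y - w))
      = (a + b) * callFn ν w + (cdfM ν w - 1) * (a * (x - w) + b * (y - w)) := by ring
    rw [e, this, hab]; ring
  linarith

lemma cdfM_mono {ν : Measure ℝ} (hν : MemM ν) : Monotone (cdfM ν) := by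
  have := hν.1
  intro x y hxy
  exact ENNReal.toReal_mono (measure_ne_top _ _) (measure_mono (Iic_subset_Iic.2 hxy))

lemma cdfM_right {ν : Measure ℝ} (hν : MemM ν) (x : ℝ) :
    Tendsto (cdfM ν) (nhdsWithin x (Ioi x)) (nhds (cdfM ν x)) := by
  have := hν.1
  have h1 : cdfM ν = ProbabilityTheory.cdf ν := by
    ext y
    rw [ProbabilityTheory.cdf_eq_real]; rfl
  rw [h1]
  exact ((ProbabilityTheory.cdf ν).right_continuous x).mono Ioi_subset_Ici_self

/-! ### Existence of a measure with a given call function -/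

lemma exists_measure_of_call (R : ℝ → ℝ) (m : ℝ) (hR : ConvexOn ℝ univ R)
    (htop : Tendsto R atTop (nhds 0)) (hbot : Tendsto (fun x => R x + x) atBot (nhds m)) :
    ∃ θ : Measure ℝ, MemM θ ∧ (∀ x, callFn θ x = R x) ∧ meanM θ = m := by
  obtain ⟨G, hG, hsub⟩ := convex_exists_stieltjes R hR
  have hlow : ∀ x, R x - R (x - 1) ≤ G x := fun x => by
    have := hsub x (x - 1)
    linarith
  have hupp : ∀ x, G x ≤ R (x + 1) - R x := fun x => by
    have := hsub x (x + 1)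
    linarith
  have hGtop : Tendsto G atTop (nhds 0) := by
    refine tendsto_of_tendsto_of_tendsto_of_le_of_le
      (g := fun x => R x - R (x - 1)) (h := fun x => R (x + 1) - R x) ?_ ?_ hlow hupp
    · simpa [← sub_eq_add_neg] using htop.sub (htop.comp (tendsto_atTop_add_const_right atTop (-1 : ℝ) tendsto_id))
    · simpa using (htop.comp (tendsto_atTop_add_const_right atTop (1 : ℝ) tendsto_id)).sub htop
  have hGbot : Tendsto G atBot (nhds (-1)) := by
    refine tendsto_of_tendsto_of_tendsto_of_le_of_le
      (g := fun x => R x - R (x - 1)) (h := fun x => R (x + 1) - R x) ?_ ?_ hlow hupp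
    · have h1 := (hbot.sub
        (hbot.comp (tendsto_atBot_add_const_right atBot (-1 : ℝ) tendsto_id))).sub_const 1
      simp only [sub_self, zero_sub] at h1
      refine h1.congr fun x => ?_
      simp only [Function.comp_apply, id_eq, ← sub_eq_add_neg]; ring
    · have h1 := ((hbot.comp (tendsto_atBot_add_const_right atBot (1 : ℝ) tendsto_id)).sub
        hbot).sub_const 1
      simp only [sub_self, zero_sub] at h1
      refine h1.congr fun x => ?_
      simp only [Function.comp_apply, id_eq]; ring
  have hG0 : ∀ x, G x ≤ 0 := fun x => G.mono.ge_of_tendsto hGtop x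
  have hG1 : ∀ x, -1 ≤ G x := fun x => G.mono.le_of_tendsto hGbot x
  have hprob : IsProbabilityMeasure G.measure := ⟨by
    rw [G.measure_univ hGbot hGtop]; simp⟩
  have hii : ∀ a b : ℝ, IntervalIntegrable G volume a b := fun a b => G.mono.intervalIntegrable
  -- right tail
  have hcall : ∀ x, ∫⁻ t, ENNReal.ofReal (t - x) ∂G.measure = ENNReal.ofReal (R x) := by
    intro x
    rw [layer_right']
    simp_rw [G.measure_Ioi hGtop]
    have hlim : Tendsto (fun b => ∫ s in x..b, (0 - G s)) atTop (nhds (R x)) := by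
      have h1 : ∀ b, ∫ s in x..b, (0 - G s) = R x - R b := by
        intro b
        rw [intervalIntegral.integral_sub (by simp) (hii x b), stieltjes_ftc R hR G hG]
        simp
      simp_rw [h1]
      simpa using htop.const_sub (R x)
    have hint : IntegrableOn (fun s => 0 - G s) (Ioi x) := by
      refine integrableOn_Ioi_of_intervalIntegral_norm_tendsto (R x) x (fun b => ?_)
        tendsto_id ?_
      · have : IntervalIntegrable (fun s => 0 - G s) volume x b :=
          IntervalIntegrable.sub (by simp) (hii x b)
        exact this.1
      · refine hlim.congr fun b => ?_
        refine intervalIntegral.integral_congr fun s _ => ?_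
        exact (Real.norm_of_nonneg (by linarith [hG0 s])).symm
    rw [← ofReal_integral_eq_lintegral_ofReal hint (ae_of_all _ fun s => by
      have := hG0 s; simp only [Pi.zero_apply]; linarith)]
    rw [tendsto_nhds_unique (intervalIntegral_tendsto_integral_Ioi x hint tendsto_id) hlim]
  have hput : ∀ x, ∫⁻ t, ENNReal.ofReal (x - t) ∂G.measure = ENNReal.ofReal (R x + x - m) := by
    intro x
    rw [layer_left]
    simp_rw [G.measure_Iic hGbot]
    have hlim : Tendsto (fun a => ∫ s in a..x, (G s - -1)) atBot (nhds (R x + x - m)) := by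
      have h1 : ∀ a, ∫ s in a..x, (G s - -1) = R x + x - (R a + a) := by
        intro b
        rw [intervalIntegral.integral_sub (hii b x) (by simp), stieltjes_ftc R hR G hG]
        simp only [intervalIntegral.integral_const, smul_eq_mul]; ring
      simp_rw [h1]
      exact hbot.const_sub _
    have hint : IntegrableOn (fun s => G s - -1) (Iic x) := by
      refine integrableOn_Iic_of_intervalIntegral_norm_tendsto (R x + x - m) x (fun b => ?_)
        tendsto_id ?_
      · have : IntervalIntegrable (fun s => G s - -1) volume b x :=
          IntervalIntegrable.sub (hii b x) (by simp)
        exact this.1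
      · refine hlim.congr fun b => ?_
        refine intervalIntegral.integral_congr fun s _ => ?_
        exact (Real.norm_of_nonneg (by linarith [hG1 s])).symm
    rw [← ofReal_integral_eq_lintegral_ofReal hint (ae_of_all _ fun s => by
      have := hG1 s; simp only [Pi.zero_apply]; linarith)]
    rw [tendsto_nhds_unique (intervalIntegral_tendsto_integral_Iic x hint tendsto_id) hlim]
  have hanti : Antitone R := by
    intro x y hxy
    have h1 := hsub y x
    have := mul_nonneg_of_nonpos_of_nonpos (hG0 y) (show x - y ≤ 0 by linarith)
    linarith
  have hR0 : ∀ x, 0 ≤ R x := fun x => hanti.le_of_tendsto htop x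
  have hmem : MemM G.measure := by
    refine ⟨hprob, measurable_id.aestronglyMeasurable, ?_⟩
    rw [hasFiniteIntegral_iff_norm]
    have h1 : ∀ y : ℝ, ENNReal.ofReal ‖y‖ ≤ ENNReal.ofReal (y - 0) + ENNReal.ofReal (0 - y) := by
      intro y
      rcases le_total 0 y with h | h
      · rw [Real.norm_of_nonneg h]; simp
      · rw [Real.norm_of_nonpos h]; simp
    refine (lintegral_mono h1).trans_lt ?_
    rw [lintegral_add_left (by fun_prop), hcall, hput]
    exact ENNReal.add_lt_top.2 ⟨ENNReal.ofReal_lt_top, ENNReal.ofReal_lt_top⟩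
  have hc : ∀ x, callFn G.measure x = R x := by
    intro x
    have h1 := hcall x
    rw [lintegral_call hmem] at h1
    exact (ENNReal.ofReal_eq_ofReal_iff (call_nonneg _ _) (hR0 x)).1 h1
  refine ⟨G.measure, hmem, hc, ?_⟩
  have h1 := call_tendsto_atBot hmem
  simp_rw [hc] at h1
  exact tendsto_nhds_unique h1 hbot

/-! ### Convex hull of two functions -/

section Conv
variable {f g : ℝ → ℝ}

lemma conv2_bdd (x : ℝ) : BddAbove {z : ℝ | ∃ h : ℝ → ℝ, ConvexOn ℝ Set.univ h ∧
    (∀ y, h y ≤ min (f y) (g y)) ∧ z = h x} := by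
  refine ⟨min (f x) (g x), ?_⟩
  rintro z ⟨h, -, h2, rfl⟩
  exact h2 x

lemma le_conv2 {h : ℝ → ℝ} (hc : ConvexOn ℝ univ h) (hle : ∀ y, h y ≤ min (f y) (g y)) (x : ℝ) :
    h x ≤ conv2 f g x :=
  le_csSup (conv2_bdd x) ⟨h, hc, hle, rfl⟩

lemma conv2_le (hf : ∀ x, 0 ≤ f x) (hg : ∀ x, 0 ≤ g x) (x : ℝ) :
    conv2 f g x ≤ min (f x) (g x) := by
  refine csSup_le ⟨0, fun _ => 0, convexOn_const 0 convex_univ,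
    fun y => le_min (hf y) (hg y), rfl⟩ ?_
  rintro z ⟨h, -, h2, rfl⟩
  exact h2 x

lemma conv2_convex (hf : ∀ x, 0 ≤ f x) (hg : ∀ x, 0 ≤ g x) : ConvexOn ℝ univ (conv2 f g) := by
  refine ⟨convex_univ, fun x _ y _ a b ha hb hab => ?_⟩
  refine csSup_le ⟨0, fun _ => 0, convexOn_const 0 convex_univ,
    fun y => le_min (hf y) (hg y), rfl⟩ ?_
  rintro z ⟨h, h1, h2, rfl⟩
  refine (h1.2 (mem_univ x) (mem_univ y) ha hb hab).trans ?_
  simp only [smul_eq_mul]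
  exact add_le_add (mul_le_mul_of_nonneg_left (le_conv2 h1 h2 x) ha)
    (mul_le_mul_of_nonneg_left (le_conv2 h1 h2 y) hb)

end Conv

lemma convexOn_line (c p y : ℝ) : ConvexOn ℝ univ (fun z : ℝ => c + p * (z - y)) := by
  refine ⟨convex_univ, fun x _ z _ a b ha hb hab => le_of_eq ?_⟩
  simp only [smul_eq_mul]
  have : b = 1 - a := by linarith
  subst this; ring

/-! ### The ball -/

lemma ball_cond {μ ν : Measure ℝ} (hμ : MemM μ) {ε : ℝ} (h : InBallWinf μ ε ν) {δ : ℝ}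
    (hδ : ε < δ) (hδ0 : 0 < δ) (x : ℝ) :
    cdfM μ (x - δ) ≤ cdfM ν x ∧ cdfM ν x ≤ cdfM μ (x + δ) := by
  have h1 : Winf μ ν < ENNReal.ofReal δ :=
    h.2.trans_lt ((ENNReal.ofReal_lt_ofReal_iff hδ0).2 hδ)
  obtain ⟨_, ⟨e, ⟨he0, he⟩, rfl⟩, he2⟩ := sInf_lt_iff.1 h1
  have he3 : e < δ := (ENNReal.ofReal_lt_ofReal_iff hδ0).1 he2
  exact ⟨(cdfM_mono hμ (by linarith)).trans (he x).1, (he x).2.trans (cdfM_mono hμ (by linarith))⟩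

lemma ball_of_slopes {μ ν₁ ν₂ θ : Measure ℝ} {ε : ℝ} (hμ : MemM μ) (hε : 0 < ε)
    (h₁ : InBallWinf μ ε ν₁) (h₂ : InBallWinf μ ε ν₂) (hθ : MemM θ)
    (hup : ∀ y z, y < z → callFn θ z - callFn θ y ≤
      (max (cdfM ν₁ z) (cdfM ν₂ z) - 1) * (z - y))
    (hlo : ∀ y z, y < z → (min (cdfM ν₁ y) (cdfM ν₂ y) - 1) * (z - y) ≤
      callFn θ z - callFn θ y) : InBallWinf μ ε θ := by
  have hup' : ∀ y, cdfM θ y ≤ max (cdfM ν₁ y) (cdfM ν₂ y) := by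
    intro y
    refine ge_of_tendsto ((cdfM_right h₁.1 y).max (cdfM_right h₂.1 y)) ?_
    filter_upwards [self_mem_nhdsWithin] with z hz
    have hz' : y < z := hz
    have h3 := (call_subgrad hθ y z)
    have h4 := hup y z hz
    have h5 : (cdfM θ y - 1) * (z - y) ≤ (max (cdfM ν₁ z) (cdfM ν₂ z) - 1) * (z - y) := by linarith
    have := le_of_mul_le_mul_right h5 (by linarith)
    linarith
  have hlo' : ∀ y, min (cdfM ν₁ y) (cdfM ν₂ y) ≤ cdfM θ y := by
    intro y
    refine ge_of_tendsto (cdfM_right hθ y) ?_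
    filter_upwards [self_mem_nhdsWithin] with z hz
    have hz' : y < z := hz
    have h3 := (call_subgrad hθ z y)
    have h4 := hlo y z hz
    have h5 : (min (cdfM ν₁ y) (cdfM ν₂ y) - 1) * (z - y) ≤ (cdfM θ z - 1) * (z - y) := by linarith
    have := le_of_mul_le_mul_right h5 (by linarith)
    linarith
  refine ⟨hθ, le_of_forall_gt_imp_ge_of_dense fun b hb => ?_⟩
  rcases eq_or_ne b ⊤ with rfl | hbt
  · exact le_top
  have hlt : ε < b.toReal := by
    rwa [← ENNReal.ofReal_lt_iff_lt_toReal hε.le hbt]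
  refine sInf_le ⟨b.toReal, ⟨hε.trans hlt, fun x => ?_⟩, ENNReal.ofReal_toReal hbt⟩
  have c1 := ball_cond hμ h₁ hlt (hε.trans hlt) x
  have c2 := ball_cond hμ h₂ hlt (hε.trans hlt) x
  exact ⟨(le_min c1.1 c2.1).trans (hlo' x), (hup' x).trans (max_le c1.2 c2.2)⟩
/-- `B∞(μ,ε) ∩ M_m` is a sublattice of `(M_m, ≤_c)`: it contains the
supremum (call function = pointwise max) and the infimum (call function = convex hull)
of any two of its elements. -/
theorem ball_winf_sublattice (μ : Measure ℝ) (hμ : MemM μ) (ε : ℝ) (hε : 0 < ε) (m : ℝ)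
    (ν₁ ν₂ : Measure ℝ)
    (h₁ : InBallWinf μ ε ν₁ ∧ meanM ν₁ = m)
    (h₂ : InBallWinf μ ε ν₂ ∧ meanM ν₂ = m) :
    (∃ θ : Measure ℝ,
      (∀ x : ℝ, callFn θ x = max (callFn ν₁ x) (callFn ν₂ x)) ∧
      InBallWinf μ ε θ ∧ meanM θ = m ∧
      ConvexOrder ν₁ θ ∧ ConvexOrder ν₂ θ ∧
      (∀ η : Measure ℝ, MemM η → meanM η = m →
        ConvexOrder ν₁ η → ConvexOrder ν₂ η → ConvexOrder θ η)) ∧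
    (∃ θ : Measure ℝ,
      (∀ x : ℝ, callFn θ x = conv2 (callFn ν₁) (callFn ν₂) x) ∧
      InBallWinf μ ε θ ∧ meanM θ = m ∧
      ConvexOrder θ ν₁ ∧ ConvexOrder θ ν₂ ∧
      (∀ η : Measure ℝ, MemM η → meanM η = m →
        ConvexOrder η ν₁ → ConvexOrder η ν₂ → ConvexOrder η θ)) := by
  obtain ⟨hb1, hm1⟩ := h₁
  obtain ⟨hb2, hm2⟩ := h₂
  have hM1 := hb1.1
  have hM2 := hb2.1
  have n1 := call_nonneg ν₁
  have n2 := call_nonneg ν₂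
  have b1 := call_tendsto_atBot hM1
  have b2 := call_tendsto_atBot hM2
  rw [hm1] at b1
  rw [hm2] at b2
  constructor
  · obtain ⟨θ, hθ, hc, hm⟩ := exists_measure_of_call
      (fun x => max (callFn ν₁ x) (callFn ν₂ x)) m ((call_convex hM1).sup (call_convex hM2))
      (by simpa using (call_tendsto_atTop hM1).max (call_tendsto_atTop hM2))
      (by simpa [max_add_add_right] using b1.max b2)
    refine ⟨θ, hc, ?_, hm, ?_, ?_, ?_⟩
    · refine ball_of_slopes hμ hε hb1 hb2 hθ ?_ ?_
      · intro y z hyz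
        rw [hc, hc]
        have s1 := call_subgrad hM1 z y
        have s2 := call_subgrad hM2 z y
        have l1 := le_max_left (callFn ν₁ y) (callFn ν₂ y)
        have l2 := le_max_right (callFn ν₁ y) (callFn ν₂ y)
        have k1 := mul_le_mul_of_nonneg_right (le_max_left (cdfM ν₁ z) (cdfM ν₂ z))
          (show 0 ≤ z - y by linarith)
        have k2 := mul_le_mul_of_nonneg_right (le_max_right (cdfM ν₁ z) (cdfM ν₂ z))
          (show 0 ≤ z - y by linarith)
        rcases max_choice (callFn ν₁ z) (callFn ν₂ z) with e | e <;> rw [e] <;> linarith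
      · intro y z hyz
        rw [hc, hc]
        have s1 := call_subgrad hM1 y z
        have s2 := call_subgrad hM2 y z
        have l1 := le_max_left (callFn ν₁ z) (callFn ν₂ z)
        have l2 := le_max_right (callFn ν₁ z) (callFn ν₂ z)
        have k1 := mul_le_mul_of_nonneg_right (min_le_left (cdfM ν₁ y) (cdfM ν₂ y))
          (show 0 ≤ z - y by linarith)
        have k2 := mul_le_mul_of_nonneg_right (min_le_right (cdfM ν₁ y) (cdfM ν₂ y))
          (show 0 ≤ z - y by linarith)
        rcases max_choice (callFn ν₁ y) (callFn ν₂ y) with e | e <;> rw [e] <;> linarith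
    · exact convexOrder_of_call_le hM1 hθ (hm1.trans hm.symm)
        fun x => by rw [hc]; exact le_max_left _ _
    · exact convexOrder_of_call_le hM2 hθ (hm2.trans hm.symm)
        fun x => by rw [hc]; exact le_max_right _ _
    · intro η hη hηm o1 o2
      refine convexOrder_of_call_le hθ hη (hm.trans hηm.symm) fun x => ?_
      rw [hc]
      exact max_le (o1.call_le hM1 hη x) (o2.call_le hM2 hη x)
  · have hle := conv2_le n1 n2
    have h0 : ∀ x, 0 ≤ conv2 (callFn ν₁) (callFn ν₂) x := fun x =>
      le_conv2 (h := fun _ => 0) (convexOn_const 0 convex_univ) (fun y => le_min (n1 y) (n2 y)) x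
    have hmx : ∀ x, m ≤ conv2 (callFn ν₁) (callFn ν₂) x + x := fun x => by
      have := le_conv2 (f := callFn ν₁) (g := callFn ν₂) (convexOn_line m (-1) 0) (fun y => by
        have p1 := put_nonneg hM1 y
        have p2 := put_nonneg hM2 y
        rw [hm1] at p1
        rw [hm2] at p2
        exact le_min (by linarith) (by linarith)) x
      linarith
    obtain ⟨θ, hθ, hc, hm⟩ := exists_measure_of_call
      (conv2 (callFn ν₁) (callFn ν₂)) m (conv2_convex n1 n2)
      (tendsto_of_tendsto_of_tendsto_of_le_of_le tendsto_const_nhds (call_tendsto_atTop hM1)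
        h0 (fun x => (hle x).trans (min_le_left _ _)))
      (tendsto_of_tendsto_of_tendsto_of_le_of_le tendsto_const_nhds b1
        hmx (fun x => by have := (hle x).trans (min_le_left _ _); simpa using this))
    have hle1 : ∀ x, callFn θ x ≤ callFn ν₁ x := fun x => by
      rw [hc]; exact (hle x).trans (min_le_left _ _)
    have hle2 : ∀ x, callFn θ x ≤ callFn ν₂ x := fun x => by
      rw [hc]; exact (hle x).trans (min_le_right _ _)
    -- a line lying below the hull-or-both functions lies below the hull
    have hline : ∀ p y, (∀ w, callFn θ y + p * (w - y) ≤ callFn θ w ∨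
        (callFn θ y + p * (w - y) ≤ callFn ν₁ w ∧ callFn θ y + p * (w - y) ≤ callFn ν₂ w)) →
        ∀ w, callFn θ y + p * (w - y) ≤ callFn θ w := by
      intro p y hw w
      rw [hc w]
      refine le_conv2 (f := callFn ν₁) (g := callFn ν₂) (convexOn_line (callFn θ y) p y)
        (fun z => ?_) w
      rcases hw z with h | ⟨h, h'⟩
      · exact le_min (h.trans (hle1 z)) (h.trans (hle2 z))
      · exact le_min h h'
    refine ⟨θ, hc, ?_, hm, ?_, ?_, ?_⟩
    · refine ball_of_slopes hμ hε hb1 hb2 hθ ?_ ?_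
      · intro y z hyz
        set P := max (cdfM ν₁ z) (cdfM ν₂ z) - 1 with hP
        have key : callFn θ z + P * (y - z) ≤ callFn θ y := by
          rcases le_total (cdfM θ z - 1) P with hr | hr
          · have := call_subgrad hθ z y
            have := mul_le_mul_of_nonneg_right hr (show 0 ≤ z - y by linarith)
            linarith
          · refine hline P z (fun w => ?_) y
            rcases le_total z w with hw | hw
            · left
              have := call_subgrad hθ z w
              have := mul_le_mul_of_nonneg_right hr (show 0 ≤ w - z by linarith)
              linarith
            · right
              have s1 := call_subgrad hM1 z w
              have s2 := call_subgrad hM2 z w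
              have k1 := mul_le_mul_of_nonneg_right (le_max_left (cdfM ν₁ z) (cdfM ν₂ z))
                (show 0 ≤ z - w by linarith)
              have k2 := mul_le_mul_of_nonneg_right (le_max_right (cdfM ν₁ z) (cdfM ν₂ z))
                (show 0 ≤ z - w by linarith)
              have a1 := hle1 z
              have a2 := hle2 z
              rw [hP]
              constructor <;> linarith
        linarith
      · intro y z hyz
        set P := min (cdfM ν₁ y) (cdfM ν₂ y) - 1 with hP
        have key : callFn θ y + P * (z - y) ≤ callFn θ z := by
          rcases le_total P (cdfM θ y - 1) with hr | hr
          · have := call_subgrad hθ y z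
            have := mul_le_mul_of_nonneg_right hr (show 0 ≤ z - y by linarith)
            linarith
          · refine hline P y (fun w => ?_) z
            rcases le_total w y with hw | hw
            · left
              have := call_subgrad hθ y w
              have := mul_le_mul_of_nonneg_right hr (show 0 ≤ y - w by linarith)
              linarith
            · right
              have s1 := call_subgrad hM1 y w
              have s2 := call_subgrad hM2 y w
              have k1 := mul_le_mul_of_nonneg_right (min_le_left (cdfM ν₁ y) (cdfM ν₂ y))
                (show 0 ≤ w - y by linarith)
              have k2 := mul_le_mul_of_nonneg_right (min_le_right (cdfM ν₁ y) (cdfM ν₂ y))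
                (show 0 ≤ w - y by linarith)
              have a1 := hle1 y
              have a2 := hle2 y
              rw [hP]
              constructor <;> linarith
        linarith
    · exact convexOrder_of_call_le hθ hM1 (hm.trans hm1.symm) hle1
    · exact convexOrder_of_call_le hθ hM2 (hm.trans hm2.symm) hle2
    · intro η hη hηm o1 o2
      refine convexOrder_of_call_le hη hθ (hηm.trans hm.symm) fun x => ?_
      rw [hc]
      exact le_conv2 (call_convex hη)
        (fun y => le_min (o1.call_le hη hM1 y) (o2.call_le hη hM2 y)) x
end

section
/- Given ε > 0, μ ∈ M and m ∈ [Eμ−ε, Eμ+ε], there exists a unique measure S(μ; m, ε) ∈ B∞(μ,ε) ∩ M_m such that S(μ; m, ε) ≤_c ν for all ν ∈ B∞(μ,ε) ∩ M_m, and its call function is R^min_μ(x; m, ε) = max{ m + R_μ(x−ε) − (Eμ+ε), R_μ(x+ε) } for all x ∈ ℝ. -/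
open MeasureTheory Filter Set
open scoped ENNReal

namespace BallAux

open ProbabilityTheory

/-- Quantile function. -/
noncomputable def qf (μ : Measure ℝ) (u : ℝ) : ℝ := sInf {x : ℝ | u ≤ cdf μ x}

/-- Uniform law on the unit interval. -/
noncomputable def PP : Measure ℝ := volume.restrict (Set.Ioo (0:ℝ) 1)

lemma qf_le_iff (μ : Measure ℝ) {u : ℝ} (hu : u ∈ Set.Ioo (0:ℝ) 1) (x : ℝ) :
    qf μ u ≤ x ↔ u ≤ cdf μ x := by
  have hne : {x : ℝ | u ≤ cdf μ x}.Nonempty := by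
    have h := (tendsto_cdf_atTop μ).eventually (lt_mem_nhds hu.2)
    obtain ⟨y, hy⟩ := h.exists
    exact ⟨y, hy.le⟩
  have hbd : BddBelow {x : ℝ | u ≤ cdf μ x} := by
    have h := (tendsto_cdf_atBot μ).eventually (gt_mem_nhds hu.1)
    obtain ⟨y, hy⟩ := h.exists
    refine ⟨y, fun z hz => ?_⟩
    by_contra hlt
    push Not at hlt
    have := monotone_cdf μ hlt.le
    have hz' : u ≤ cdf μ z := hz
    linarith
  constructor
  · intro h
    have hc : ContinuousWithinAt (cdf μ) (Set.Ioi x) x :=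
      ((cdf μ).right_continuous x).mono Set.Ioi_subset_Ici_self
    refine ge_of_tendsto hc ?_
    filter_upwards [self_mem_nhdsWithin] with y hy
    have hy' : sInf {x : ℝ | u ≤ cdf μ x} < y := lt_of_le_of_lt h hy
    obtain ⟨z, hz, hzy⟩ := exists_lt_of_csInf_lt hne hy'
    exact le_trans hz (monotone_cdf μ hzy.le)
  · intro h
    exact csInf_le hbd h

lemma qf_aemeasurable (μ : Measure ℝ) : AEMeasurable (qf μ) PP := by
  refine aemeasurable_restrict_of_monotoneOn measurableSet_Ioo ?_
  intro a ha b hb hab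
  rw [qf_le_iff μ ha]
  exact hab.trans ((qf_le_iff μ hb _).1 le_rfl)

instance : IsProbabilityMeasure PP := ⟨by simp [PP]⟩

lemma map_qf (μ : Measure ℝ) [IsProbabilityMeasure μ] : PP.map (qf μ) = μ := by
  have := Measure.isProbabilityMeasure_map (qf_aemeasurable μ)
  refine Measure.ext_of_Iic _ _ fun x => ?_
  rw [Measure.map_apply_of_aemeasurable (qf_aemeasurable μ) measurableSet_Iic, ← ofReal_cdf μ x]
  have h1 : PP (qf μ ⁻¹' Set.Iic x) = PP (Set.Iic (cdf μ x)) := by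
    refine measure_congr ?_
    refine (ae_restrict_iff' measurableSet_Ioo).2 (Eventually.of_forall fun u hu => ?_)
    exact propext (qf_le_iff μ hu x)
  rw [h1, PP, Measure.restrict_apply measurableSet_Iic]
  have h0 := cdf_nonneg μ x
  have h1 := cdf_le_one μ x
  apply le_antisymm
  · calc volume (Set.Iic (cdf μ x) ∩ Set.Ioo 0 1) ≤ volume (Set.Icc 0 (cdf μ x)) :=
          measure_mono fun y hy => ⟨hy.2.1.le, hy.1⟩
      _ = _ := by simp
  · calc ENNReal.ofReal (cdf μ x) = volume (Set.Ioo 0 (cdf μ x)) := by simp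
      _ ≤ _ := by
        refine measure_mono ?_
        intro y hy
        exact ⟨hy.2.le, hy.1, hy.2.trans_le h1⟩

lemma cdfM_eq (μ : Measure ℝ) [IsProbabilityMeasure μ] (x : ℝ) : cdfM μ x = cdf μ x := by
  rw [cdf_eq_real]; rfl

lemma coupling {ε : ℝ} (hε : 0 < ε) {μ ν : Measure ℝ} [IsProbabilityMeasure μ]
    [IsProbabilityMeasure ν] (h : Winf μ ν ≤ ENNReal.ofReal ε) {u : ℝ}
    (hu : u ∈ Set.Ioo (0:ℝ) 1) : |qf ν u - qf μ u| ≤ ε := by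
  refine le_of_forall_gt_imp_ge_of_dense fun e he => ?_
  have he0 : 0 < e := hε.trans he
  have h2 : Winf μ ν < ENNReal.ofReal e :=
    h.trans_lt ((ENNReal.ofReal_lt_ofReal_iff he0).2 he)
  obtain ⟨_, ⟨d, ⟨hd0, hd⟩, rfl⟩, hlt⟩ := sInf_lt_iff.1 h2
  have hde : d < e := (ENNReal.ofReal_lt_ofReal_iff he0).1 hlt
  simp only [cdfM_eq] at hd
  have ha : qf ν u ≤ qf μ u + d := by
    rw [qf_le_iff ν hu]
    have := (hd (qf μ u + d)).1
    rw [add_sub_cancel_right] at this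
    exact ((qf_le_iff μ hu _).1 le_rfl).trans this
  have hb : qf μ u ≤ qf ν u + d := by
    rw [qf_le_iff μ hu]
    exact ((qf_le_iff ν hu _).1 le_rfl).trans (hd (qf ν u)).2
  rw [abs_le]; constructor <;> linarith

/-- Call functions determine a probability measure. -/
lemma ext_callFn {μ ν : Measure ℝ} (hμ : MemM μ) (hν : MemM ν)
    (h : ∀ x, callFn μ x = callFn ν x) : μ = ν := by
  have key : ∀ (ρ : Measure ℝ), MemM ρ → ∀ x, Tendsto
      (fun n : ℕ => ((n:ℝ) + 1) * (callFn ρ x - callFn ρ (x + 1 / ((n:ℝ) + 1)))) atTop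
      (nhds (ρ.real (Set.Ioi x))) := by
    intro ρ hρ x
    have := hρ.1
    have hint : ∀ a, Integrable (fun y => max (y - a) 0) ρ := fun a =>
      (hρ.2.sub (integrable_const a)).pos_part
    have heq : ∀ n : ℕ, ((n:ℝ) + 1) * (callFn ρ x - callFn ρ (x + 1 / ((n:ℝ) + 1)))
        = ∫ y, ((n:ℝ) + 1) * (max (y - x) 0 - max (y - (x + 1 / ((n:ℝ) + 1))) 0) ∂ρ := by
      intro n
      rw [integral_const_mul, integral_sub (hint _) (hint _)]; rfl
    simp_rw [heq]
    rw [← integral_indicator_one measurableSet_Ioi]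
    refine tendsto_integral_of_dominated_convergence (fun _ => (1:ℝ)) ?_ (integrable_const _) ?_ ?_
    · intro n
      exact (((hint _).sub (hint _)).const_mul _).aestronglyMeasurable
    · intro n
      refine Eventually.of_forall fun y => ?_
      have hn : (0:ℝ) < (n:ℝ) + 1 := by positivity
      have h1 : 0 < 1 / ((n:ℝ) + 1) := by positivity
      have h2 : ((n:ℝ) + 1) * (1 / ((n:ℝ) + 1)) = 1 := by field_simp
      have h3 : 0 ≤ max (y - x) 0 - max (y - (x + 1 / ((n:ℝ) + 1))) 0 := by
        rcases max_cases (y - x) 0 with ⟨e1, _⟩ | ⟨e1, _⟩ <;>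
        rcases max_cases (y - (x + 1 / ((n:ℝ) + 1))) 0 with ⟨e2, _⟩ | ⟨e2, _⟩ <;>
        rw [e1, e2] <;> linarith
      have h4 : max (y - x) 0 - max (y - (x + 1 / ((n:ℝ) + 1))) 0 ≤ 1 / ((n:ℝ) + 1) := by
        rcases max_cases (y - x) 0 with ⟨e1, _⟩ | ⟨e1, _⟩ <;>
        rcases max_cases (y - (x + 1 / ((n:ℝ) + 1))) 0 with ⟨e2, _⟩ | ⟨e2, _⟩ <;>
        rw [e1, e2] <;> linarith
      rw [Real.norm_of_nonneg (mul_nonneg hn.le h3)]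
      exact (mul_le_mul_of_nonneg_left h4 hn.le).trans_eq h2
    · refine Eventually.of_forall fun y => ?_
      refine tendsto_const_nhds.congr' ?_
      by_cases hy : x < y
      · have ht := tendsto_one_div_add_atTop_nhds_zero_nat (𝕜 := ℝ)
        filter_upwards [ht.eventually (gt_mem_nhds (sub_pos.2 hy))] with n hn
        have hn' : (0:ℝ) < (n:ℝ) + 1 := by positivity
        rw [Set.indicator_of_mem (show y ∈ Set.Ioi x from hy), max_eq_left (by linarith),
          max_eq_left (by linarith)]
        simp only [Pi.one_apply]
        field_simp
        ring
      · refine Eventually.of_forall fun n => ?_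
        have h1 : 0 < 1 / ((n:ℝ) + 1) := by positivity
        push Not at hy
        beta_reduce
        rw [Set.indicator_of_notMem (show y ∉ Set.Ioi x from not_lt.2 hy),
          max_eq_right (show y - x ≤ 0 by linarith),
          max_eq_right (show y - (x + 1 / ((n:ℝ) + 1)) ≤ 0 by linarith)]
        simp
  have := hμ.1
  have := hν.1
  refine Measure.ext_of_Iic _ _ fun x => ?_
  have h1 := key μ hμ x
  have h2 := key ν hν x
  simp_rw [h] at h1
  have h3 := tendsto_nhds_unique h1 h2
  rw [← Set.compl_Iic, probReal_compl_eq_one_sub measurableSet_Iic,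
    probReal_compl_eq_one_sub measurableSet_Iic] at h3
  have h4 : μ.real (Set.Iic x) = ν.real (Set.Iic x) := by linarith
  exact (measureReal_eq_measureReal_iff).1 h4

lemma memM_map {ε : ℝ} {μ : Measure ℝ} (hμ : MemM μ) {T : ℝ → ℝ} (hT : Measurable T)
    (hTe : ∀ y, |T y - y| ≤ ε) : Integrable T μ ∧ MemM (μ.map T) := by
  have := hμ.1
  have hd : Integrable (fun y => T y - y) μ :=
    Integrable.mono' (integrable_const ε) (hT.sub measurable_id).aestronglyMeasurable
      (Eventually.of_forall hTe)
  have hi : Integrable T μ := by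
    have := hd.add hμ.2
    refine this.congr (Eventually.of_forall fun y => ?_)
    simp
  exact ⟨hi, Measure.isProbabilityMeasure_map hT.aemeasurable,
    (integrable_map_measure (by fun_prop) hT.aemeasurable).2 hi⟩

lemma inBall_map {ε : ℝ} (hε : 0 < ε) {μ : Measure ℝ} (hμ : MemM μ) {T : ℝ → ℝ}
    (hT : Measurable T) (hTe : ∀ y, |T y - y| ≤ ε) : InBallWinf μ ε (μ.map T) := by
  have := hμ.1
  refine ⟨(memM_map hμ hT hTe).2, sInf_le ⟨ε, ⟨hε, fun x => ?_⟩, rfl⟩⟩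
  unfold cdfM
  rw [Measure.map_apply hT measurableSet_Iic]
  constructor
  · refine ENNReal.toReal_mono (measure_ne_top _ _) (measure_mono fun y hy => ?_)
    have := abs_le.1 (hTe y)
    simp only [Set.mem_Iic, Set.mem_preimage] at *
    linarith
  · refine ENNReal.toReal_mono (measure_ne_top _ _) (measure_mono fun y hy => ?_)
    have := abs_le.1 (hTe y)
    simp only [Set.mem_Iic, Set.mem_preimage] at *
    linarith

lemma callFn_map {ε m : ℝ} {μ : Measure ℝ} (hμ : MemM μ) {T : ℝ → ℝ}
    (hT : Measurable T) (hTe : ∀ y, |T y - y| ≤ ε) (hm : ∫ y, T y ∂μ = m) (x : ℝ)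
    (hx : (∀ y, max (T y - x) 0 = max (y - (x + ε)) 0) ∨
      (∀ y, max (T y - x) 0 = T y - y - ε + max (y - (x - ε)) 0)) :
    callFn (μ.map T) x = max (m + callFn μ (x - ε) - (meanM μ + ε)) (callFn μ (x + ε)) := by
  have := hμ.1
  have hi := (memM_map hμ hT hTe).1
  have hint : ∀ a, Integrable (fun y => max (y - a) 0) μ := fun a =>
    (hμ.2.sub (integrable_const a)).pos_part
  have hintT : Integrable (fun y => max (T y - x) 0) μ :=
    (hi.sub (integrable_const x)).pos_part
  have e0 : callFn (μ.map T) x = ∫ y, max (T y - x) 0 ∂μ := by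
    unfold callFn
    rw [integral_map hT.aemeasurable (by fun_prop)]
  have i1 : Integrable (fun y => T y - y - ε) μ := (hi.sub hμ.2).sub (integrable_const ε)
  have e1 : ∫ y, (T y - y - ε + max (y - (x - ε)) 0) ∂μ
      = m + callFn μ (x - ε) - (meanM μ + ε) := by
    have i2 : Integrable (fun y => T y - y) μ := hi.sub hμ.2
    rw [integral_add i1 (hint _), integral_sub i2 (integrable_const ε),
      integral_sub hi hμ.2, hm]
    simp only [integral_const, probReal_univ, one_smul]
    unfold callFn meanM
    ring
  have l1 : m + callFn μ (x - ε) - (meanM μ + ε) ≤ callFn (μ.map T) x := by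
    rw [← e1, e0]
    refine integral_mono (i1.add (hint _)) hintT fun y => ?_
    have := abs_le.1 (hTe y)
    simp only
    rcases max_cases (T y - x) 0 with ⟨h1, _⟩ | ⟨h1, _⟩ <;>
    rcases max_cases (y - (x - ε)) 0 with ⟨h2, _⟩ | ⟨h2, _⟩ <;>
    rw [h1, h2] <;> linarith
  have l2 : callFn μ (x + ε) ≤ callFn (μ.map T) x := by
    rw [e0]
    refine integral_mono (hint _) hintT fun y => ?_
    have := abs_le.1 (hTe y)
    simp only
    exact max_le_max (by linarith) le_rfl
  rcases hx with hx | hx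
  · have : callFn (μ.map T) x = callFn μ (x + ε) := by
      rw [e0]; simp_rw [hx]; rfl
    rw [this] at l1 ⊢
    exact (max_eq_right l1).symm
  · have : callFn (μ.map T) x = m + callFn μ (x - ε) - (meanM μ + ε) := by
      rw [e0, ← e1]; simp_rw [hx]
    rw [this] at l2 ⊢
    exact (max_eq_left l2).symm

lemma convexOrder_map {ε m : ℝ} (hε : 0 < ε) {μ ν : Measure ℝ} (hμ : MemM μ) {T : ℝ → ℝ}
    (hT : Measurable T) (hTe : ∀ y, |T y - y| ≤ ε) (hm : ∫ y, T y ∂μ = m)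
    (hν : InBallWinf μ ε ν) (hνm : meanM ν = m)
    (H : (∀ y, T y = y + ε) ∨ (∀ y, T y = y - ε) ∨
      ∀ φ : ℝ → ℝ, ConvexOn ℝ Set.univ φ → ∃ k : ℝ, ∀ y n, |n - y| ≤ ε →
        k * (n - T y) ≤ φ n - φ (T y)) :
    ConvexOrder (μ.map T) ν := by
  intro φ hφ hi1 hi2
  have := hμ.1
  have := hν.1.1
  have qa := qf_aemeasurable μ
  have qb := qf_aemeasurable ν
  have mμ := map_qf μ
  have mν := map_qf ν
  have hTq : AEMeasurable (fun u => T (qf μ u)) PP := hT.comp_aemeasurable qa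
  have mS : PP.map (fun u => T (qf μ u)) = μ.map T := by
    have := (AEMeasurable.map_map_of_aemeasurable (μ := PP) (g := T) (f := qf μ)
      hT.aemeasurable qa)
    rw [mμ] at this
    exact this.symm
  have hS := memM_map hμ hT hTe
  have hcl : ∀ᵐ u ∂PP, |qf ν u - qf μ u| ≤ ε :=
    (ae_restrict_iff' measurableSet_Ioo).2 (Eventually.of_forall fun u hu => coupling hε hν.2 hu)
  have iN : Integrable (fun u => qf ν u) PP := by
    have := hν.1.2
    rw [← mν] at this
    exact (integrable_map_measure this.1 qb).1 this
  have iT : Integrable (fun u => T (qf μ u)) PP := by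
    have := hS.2.2
    rw [← mS] at this
    exact (integrable_map_measure this.1 hTq).1 this
  have eN : ∫ u, qf ν u ∂PP = m := by
    rw [← hνm]; unfold meanM
    conv_rhs => rw [← mν]
    rw [integral_map qb (by fun_prop)]
  have eT : ∫ u, T (qf μ u) ∂PP = m := by
    rw [← hm]
    conv_rhs => rw [← mμ]
    rw [integral_map qa hT.aestronglyMeasurable]
  rw [← mS] at hi1 ⊢
  have hi2' := hi2
  rw [← mν] at hi2'
  have fN : ∫ y, φ y ∂ν = ∫ u, φ (qf ν u) ∂PP := by
    conv_lhs => rw [← mν]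
    rw [integral_map qb hi2'.1]
  rw [fN, integral_map hTq hi1.1]
  have jN : Integrable (fun u => φ (qf ν u)) PP := (integrable_map_measure hi2'.1 qb).1 hi2'
  have jT : Integrable (fun u => φ (T (qf μ u))) PP := (integrable_map_measure hi1.1 hTq).1 hi1
  rcases H with H | H | H
  · have h0 : (fun u => T (qf μ u) - qf ν u) =ᵐ[PP] 0 := by
      have i3 : Integrable (fun u => T (qf μ u) - qf ν u) PP := iT.sub iN
      refine (integral_eq_zero_iff_of_nonneg_ae ?_ i3).1 ?_
      · filter_upwards [hcl] with u hu
        have := abs_le.1 hu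
        simp only [Pi.zero_apply, H]; linarith
      · rw [integral_sub iT iN, eN, eT, sub_self]
    refine le_of_eq (integral_congr_ae ?_)
    filter_upwards [h0] with u hu
    simp only [Pi.zero_apply] at hu
    rw [sub_eq_zero.1 hu]
  · have h0 : (fun u => qf ν u - T (qf μ u)) =ᵐ[PP] 0 := by
      have i3 : Integrable (fun u => qf ν u - T (qf μ u)) PP := iN.sub iT
      refine (integral_eq_zero_iff_of_nonneg_ae ?_ i3).1 ?_
      · filter_upwards [hcl] with u hu
        have := abs_le.1 hu
        simp only [Pi.zero_apply, H]; linarith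
      · rw [integral_sub iN iT, eN, eT, sub_self]
    refine le_of_eq (integral_congr_ae ?_)
    filter_upwards [h0] with u hu
    simp only [Pi.zero_apply] at hu
    rw [sub_eq_zero.1 hu]
  · obtain ⟨k, hk⟩ := H φ hφ
    have h1 : ∫ u, k * (qf ν u - T (qf μ u)) ∂PP ≤ ∫ u, (φ (qf ν u) - φ (T (qf μ u))) ∂PP := by
      refine integral_mono_ae ((iN.sub iT).const_mul k) (jN.sub jT) ?_
      filter_upwards [hcl] with u hu
      exact hk _ _ hu
    rw [integral_const_mul, integral_sub iN iT, eN, eT, integral_sub jN jT] at h1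
    linarith

/-- Clamp of `c` to `[y-ε, y+ε]`. -/
noncomputable def clampT (ε c y : ℝ) : ℝ := max (y - ε) (min (y + ε) c)

lemma clampT_meas (ε c : ℝ) : Measurable (clampT ε c) := by
  unfold clampT; fun_prop

lemma clampT_le {ε : ℝ} (hε : 0 < ε) (c y : ℝ) : |clampT ε c y - y| ≤ ε := by
  unfold clampT
  rw [abs_le]
  rcases max_cases (y - ε) (min (y + ε) c) with ⟨h1, _⟩ | ⟨h1, _⟩ <;>
  rcases min_cases (y + ε) c with ⟨h2, _⟩ | ⟨h2, _⟩ <;>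
  rw [h1] <;> constructor <;> linarith

lemma clampT_convex {ε : ℝ} (hε : 0 < ε) (c : ℝ) (φ : ℝ → ℝ) (hφ : ConvexOn ℝ Set.univ φ) :
    ∃ k : ℝ, ∀ y n, |n - y| ≤ ε → k * (n - clampT ε c y) ≤ φ n - φ (clampT ε c y) := by
  have hup : ∀ t n, c ≤ t → t ≤ n → derivWithin φ (Set.Ioi c) c * (n - t) ≤ φ n - φ t := by
    intro t n hct htn
    rcases htn.eq_or_lt with rfl | htn
    · simp
    have h1 : derivWithin φ (Set.Ioi c) c ≤ derivWithin φ (Set.Ioi t) t :=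
      hφ.monotoneOn_rightDeriv (by simp) (by simp) hct
    have h2 := hφ.rightDeriv_le_slope_of_mem_interior (x := t) (y := n) (by simp) (by simp) htn
    have h3 := h1.trans h2
    rwa [slope_def_field, le_div_iff₀ (sub_pos.2 htn)] at h3
  have hdn : ∀ t n, t ≤ c → n ≤ t → derivWithin φ (Set.Ioi c) c * (n - t) ≤ φ n - φ t := by
    intro t n hct htn
    rcases htn.eq_or_lt with rfl | htn
    · simp
    have h1 : derivWithin φ (Set.Ioi t) t ≤ derivWithin φ (Set.Ioi c) c :=
      hφ.monotoneOn_rightDeriv (by simp) (by simp) hct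
    have h0 := hφ.leftDeriv_le_rightDeriv_of_mem_interior (x := t) (by simp)
    have h2 := hφ.slope_le_leftDeriv_of_mem_interior (x := n) (y := t) (by simp) (by simp) htn
    have h3 := h2.trans (h0.trans h1)
    rw [slope_def_field, div_le_iff₀ (sub_pos.2 htn)] at h3
    linarith
  refine ⟨derivWithin φ (Set.Ioi c) c, fun y n hn => ?_⟩
  have hn := abs_le.1 hn
  have hcase : clampT ε c y = c ∨ (c ≤ clampT ε c y ∧ clampT ε c y ≤ n) ∨
      (clampT ε c y ≤ c ∧ n ≤ clampT ε c y) := by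
    unfold clampT
    rcases max_cases (y - ε) (min (y + ε) c) with ⟨h1, _⟩ | ⟨h1, _⟩ <;>
    rcases min_cases (y + ε) c with ⟨h2, _⟩ | ⟨h2, _⟩ <;>
    rw [h1]
    · right; left; constructor <;> linarith
    · right; left; constructor <;> linarith
    · right; right; constructor <;> linarith
    · left; exact h2
  rcases hcase with h | h | h
  · rcases le_total c n with h' | h'
    · exact hup _ _ h.ge (h.le.trans h')
    · exact hdn _ _ h.le (h'.trans h.ge)
  · exact hup _ _ h.1 h.2
  · exact hdn _ _ h.1 h.2

lemma clampT_call {ε : ℝ} (hε : 0 < ε) (c x : ℝ) :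
    (∀ y, max (clampT ε c y - x) 0 = max (y - (x + ε)) 0) ∨
      (∀ y, max (clampT ε c y - x) 0 = clampT ε c y - y - ε + max (y - (x - ε)) 0) := by
  rcases le_total c x with h | h
  · left; intro y
    unfold clampT
    rcases max_cases (y - ε) (min (y + ε) c) with ⟨h1, _⟩ | ⟨h1, _⟩ <;>
    rcases min_cases (y + ε) c with ⟨h2, _⟩ | ⟨h2, _⟩ <;>
    rw [h1] <;>
    first
    | (rw [sub_sub, add_comm ε x]; done)
    | (rw [max_eq_right (by linarith), max_eq_right (by linarith)])
  · right; intro y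
    unfold clampT
    rcases max_cases (y - ε) (min (y + ε) c) with ⟨h1, _⟩ | ⟨h1, _⟩ <;>
    rcases min_cases (y + ε) c with ⟨h2, _⟩ | ⟨h2, _⟩ <;>
    rcases max_cases (y - (x - ε)) 0 with ⟨h3, _⟩ | ⟨h3, _⟩ <;>
    rw [h1, h3] <;>
    first
    | (exfalso; linarith)
    | (rw [max_eq_left (by linarith)]; linarith)
    | (rw [max_eq_right (by linarith)]; linarith)

lemma exists_clamp {ε m : ℝ} (hε : 0 < ε) {μ : Measure ℝ} (hμ : MemM μ)
    (h1 : meanM μ - ε < m) (h2 : m < meanM μ + ε) : ∃ c, ∫ y, clampT ε c y ∂μ = m := by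
  have := hμ.1
  have hb : Integrable (fun y => |y| + ε) μ := hμ.2.abs.add (integrable_const ε)
  have hbd : ∀ c y, ‖clampT ε c y‖ ≤ |y| + ε := by
    intro c y
    have h := clampT_le hε c y
    have h3 := abs_add_le (clampT ε c y - y) y
    rw [sub_add_cancel] at h3
    rw [Real.norm_eq_abs]; linarith
  have hcont : Continuous (fun c => ∫ y, clampT ε c y ∂μ) := by
    refine continuous_of_dominated (bound := fun y => |y| + ε)
      (fun c => (clampT_meas ε c).aestronglyMeasurable)
      (fun c => Eventually.of_forall (hbd c)) hb (Eventually.of_forall fun y => ?_)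
    unfold clampT; fun_prop
  have hmp : ∫ y, (y + ε) ∂μ = meanM μ + ε := by
    rw [integral_add hμ.2 (integrable_const ε)]; simp [meanM]
  have hmm : ∫ y, (y - ε) ∂μ = meanM μ - ε := by
    rw [integral_sub hμ.2 (integrable_const ε)]; simp [meanM]
  have ht : Tendsto (fun c => ∫ y, clampT ε c y ∂μ) atTop (nhds (meanM μ + ε)) := by
    rw [← hmp]
    refine tendsto_integral_filter_of_dominated_convergence (fun y => |y| + ε)
      (Eventually.of_forall fun c => (clampT_meas ε c).aestronglyMeasurable)
      (Eventually.of_forall fun c => Eventually.of_forall (hbd c)) hb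
      (Eventually.of_forall fun y => ?_)
    refine tendsto_const_nhds.congr' ?_
    filter_upwards [eventually_ge_atTop (y + ε)] with c hc
    unfold clampT
    rw [min_eq_left hc, max_eq_right (by linarith)]
  have hbt : Tendsto (fun c => ∫ y, clampT ε c y ∂μ) atBot (nhds (meanM μ - ε)) := by
    rw [← hmm]
    refine tendsto_integral_filter_of_dominated_convergence (fun y => |y| + ε)
      (Eventually.of_forall fun c => (clampT_meas ε c).aestronglyMeasurable)
      (Eventually.of_forall fun c => Eventually.of_forall (hbd c)) hb
      (Eventually.of_forall fun y => ?_)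
    refine tendsto_const_nhds.congr' ?_
    filter_upwards [eventually_le_atBot (y - ε)] with c hc
    unfold clampT
    rw [min_eq_right (by linarith), max_eq_left hc]
  obtain ⟨a, ha⟩ := (hbt.eventually (gt_mem_nhds h1)).exists
  obtain ⟨b, hb⟩ := (ht.eventually (lt_mem_nhds h2)).exists
  exact mem_range_of_exists_le_of_exists_ge hcont ⟨a, ha.le⟩ ⟨b, hb.le⟩

/-- The transport map producing the least element. -/
lemma exists_T {ε m : ℝ} (hε : 0 < ε) {μ : Measure ℝ} (hμ : MemM μ)
    (hm : m ∈ Set.Icc (meanM μ - ε) (meanM μ + ε)) :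
    ∃ T : ℝ → ℝ, Measurable T ∧ (∀ y, |T y - y| ≤ ε) ∧ ∫ y, T y ∂μ = m ∧
      (∀ x, (∀ y, max (T y - x) 0 = max (y - (x + ε)) 0) ∨
        (∀ y, max (T y - x) 0 = T y - y - ε + max (y - (x - ε)) 0)) ∧
      ((∀ y, T y = y + ε) ∨ (∀ y, T y = y - ε) ∨
      ∀ φ : ℝ → ℝ, ConvexOn ℝ Set.univ φ → ∃ k : ℝ, ∀ y n, |n - y| ≤ ε →
        k * (n - T y) ≤ φ n - φ (T y)) := by
  have := hμ.1
  rcases hm.1.eq_or_lt with h1 | h1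
  · refine ⟨fun y => y - ε, by fun_prop, fun y => ?_, ?_, fun x => Or.inl fun y => ?_,
      Or.inr (Or.inl fun y => rfl)⟩
    · rw [sub_sub_cancel_left, abs_neg, abs_of_pos hε]
    · rw [integral_sub hμ.2 (integrable_const ε), ← h1]; simp [meanM]
    · congr 1; ring
  rcases hm.2.eq_or_lt with h2 | h2
  · refine ⟨fun y => y + ε, by fun_prop, fun y => ?_, ?_, fun x => Or.inr fun y => ?_,
      Or.inl fun y => rfl⟩
    · rw [add_sub_cancel_left, abs_of_pos hε]
    · rw [integral_add hμ.2 (integrable_const ε), h2]; simp [meanM]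
    · have : y + ε - x = y - (x - ε) := by ring
      simp only [this]; ring
  · obtain ⟨c, hc⟩ := exists_clamp hε hμ h1 h2
    exact ⟨clampT ε c, clampT_meas ε c, clampT_le hε c, hc, clampT_call hε c,
      Or.inr (Or.inr (clampT_convex hε c))⟩

end BallAux

/-- existence and uniqueness of the least element `S(μ; m, ε)` of
`B∞(μ,ε) ∩ M_m` in convex order, with call function `R^min_μ(·; m, ε)`. -/
theorem ball_winf_least_element (ε : ℝ) (hε : 0 < ε) (μ : Measure ℝ) (hμ : MemM μ)
    (m : ℝ) (hm : m ∈ Set.Icc (meanM μ - ε) (meanM μ + ε)) :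
    ∃! S : Measure ℝ,
      (InBallWinf μ ε S ∧ meanM S = m) ∧
      (∀ ν : Measure ℝ, InBallWinf μ ε ν → meanM ν = m → ConvexOrder S ν) ∧
      (∀ x : ℝ, callFn S x
        = max (m + callFn μ (x - ε) - (meanM μ + ε)) (callFn μ (x + ε))) := by
  obtain ⟨T, hT, hTe, hTm, hcall, hconv⟩ := BallAux.exists_T hε hμ hm
  refine ⟨μ.map T, ⟨⟨BallAux.inBall_map hε hμ hT hTe, ?_⟩, ?_, ?_⟩, ?_⟩
  · unfold meanM
    rw [integral_map hT.aemeasurable (by fun_prop)]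
    exact hTm
  · intro ν hν hνm
    exact BallAux.convexOrder_map hε hμ hT hTe hTm hν hνm hconv
  · intro x
    exact BallAux.callFn_map hμ hT hTe hTm x (hcall x)
  · rintro S' ⟨⟨hS', _⟩, _, hc'⟩
    refine BallAux.ext_callFn hS'.1 (BallAux.memM_map hμ hT hTe).2 fun x => ?_
    rw [hc' x, BallAux.callFn_map hμ hT hTe hTm x (hcall x)]
end

section
/- Given ε > 0, μ ∈ M and m ∈ [Eμ−ε, Eμ+ε], there exists a unique measure T(μ; m, ε) ∈ B∞(μ,ε) ∩ M_m such that ν ≤_c T(μ; m, ε) for all ν ∈ B∞(μ,ε) ∩ M_m, and its call function is R^max_μ(x; m, ε) = conv( m + R_μ(·+ε) − (Eμ−ε), R_μ(·−ε) )(x), where conv(f,g) denotes the largest convex function majorized by min(f,g). -/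
open MeasureTheory Filter Set
open scoped ENNReal

lemma aux_subgrad (φ : ℝ → ℝ) (hφ : ConvexOn ℝ Set.univ φ) (d : ℝ) :
    ∃ s : ℝ, (∀ z y, z ≤ y → y ≤ d → s * (z - y) ≤ φ z - φ y) ∧
      (∀ z y, d ≤ y → y ≤ z → s * (z - y) ≤ φ z - φ y) := by
  have hmono := hφ.monotoneOn_rightDeriv
  simp only [interior_univ] at hmono
  refine ⟨derivWithin φ (Ioi d) d, ?_, ?_⟩
  · intro z y hzy hyd
    rcases hzy.eq_or_lt with rfl | h
    · simp
    have h1 := hφ.slope_le_leftDeriv_of_mem_interior (x := z) (y := y) (by simp) (by simp) h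
    have h2 := hφ.leftDeriv_le_rightDeriv_of_mem_interior (x := y) (by simp)
    have h3 := hmono (mem_univ y) (mem_univ d) hyd
    have h4 : slope φ z y ≤ derivWithin φ (Ioi d) d := h1.trans (h2.trans h3)
    rw [slope_def_field, div_le_iff₀ (by linarith)] at h4
    linarith
  · intro z y hdy hyz
    rcases hyz.eq_or_lt with rfl | h
    · simp
    have h1 := hφ.rightDeriv_le_slope_of_mem_interior (x := y) (y := z) (by simp) (by simp) h
    have h3 := hmono (mem_univ d) (mem_univ y) hdy
    have h4 : derivWithin φ (Ioi d) d ≤ slope φ y z := h3.trans h1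
    rw [slope_def_field, le_div_iff₀ (by linarith)] at h4
    linarith

lemma aux_cdf (μ : Measure ℝ) [IsProbabilityMeasure μ] (x : ℝ) :
    cdfM μ x = ProbabilityTheory.cdf μ x := by
  rw [ProbabilityTheory.cdf_eq_real]; rfl

/-- Lebesgue measure on the open unit interval. -/
noncomputable def unitP : Measure ℝ := volume.restrict (Ioo (0 : ℝ) 1)

instance : IsProbabilityMeasure unitP := ⟨by simp [unitP]⟩

lemma unitP_Iic (p : ℝ) (hp : p ∈ Icc (0 : ℝ) 1) : unitP (Iic p) = ENNReal.ofReal p := by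
  unfold unitP
  rw [restrict_Ioo_eq_restrict_Ioc, Measure.restrict_apply measurableSet_Iic]
  have : Iic p ∩ Ioc (0 : ℝ) 1 = Ioc 0 p := by
    ext x; simp only [mem_inter_iff, mem_Iic, mem_Ioc]
    have := hp.2
    constructor
    · rintro ⟨a, b, c⟩; exact ⟨b, a⟩
    · rintro ⟨a, b⟩; exact ⟨b, a, b.trans this⟩
  rw [this]; simp

lemma ae_unitP : ∀ᵐ u ∂unitP, u ∈ Ioo (0 : ℝ) 1 := ae_restrict_mem measurableSet_Ioo

lemma aux_quantile (ν : Measure ℝ) [IsProbabilityMeasure ν] :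
    ∃ q : ℝ → ℝ, MonotoneOn q (Ioo 0 1) ∧ AEMeasurable q unitP ∧ unitP.map q = ν ∧
      ∀ u ∈ Ioo (0 : ℝ) 1, ∀ x, q u ≤ x ↔ u ≤ cdfM ν x := by
  set F := ProbabilityTheory.cdf ν with hF
  let S : ℝ → Set ℝ := fun u => {x | u ≤ F x}
  have hne : ∀ u ∈ Ioo (0 : ℝ) 1, (S u).Nonempty := by
    intro u hu
    obtain ⟨x, hx⟩ := ((ProbabilityTheory.tendsto_cdf_atTop ν).eventually (lt_mem_nhds hu.2)).exists
    exact ⟨x, hx.le⟩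
  have hbd : ∀ u ∈ Ioo (0 : ℝ) 1, BddBelow (S u) := by
    intro u hu
    obtain ⟨x, hx⟩ := ((ProbabilityTheory.tendsto_cdf_atBot ν).eventually (gt_mem_nhds hu.1)).exists
    refine ⟨x, fun y hy => ?_⟩
    by_contra hlt
    have := ProbabilityTheory.monotone_cdf ν (not_le.1 hlt).le
    have h2 : u ≤ F y := hy
    linarith
  have hmem : ∀ u ∈ Ioo (0 : ℝ) 1, u ≤ F (sInf (S u)) := by
    intro u hu
    have hrc : Tendsto F (nhdsWithin (sInf (S u)) (Ioi (sInf (S u)))) (nhds (F (sInf (S u)))) :=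
      (F.right_continuous (sInf (S u))).mono_left (nhdsWithin_mono _ Ioi_subset_Ici_self)
    refine ge_of_tendsto hrc ?_
    filter_upwards [self_mem_nhdsWithin] with y hy
    obtain ⟨z, hz, hzy⟩ := exists_lt_of_csInf_lt (hne u hu) hy
    exact le_trans hz (ProbabilityTheory.monotone_cdf ν hzy.le)
  have hiff : ∀ u ∈ Ioo (0 : ℝ) 1, ∀ x, sInf (S u) ≤ x ↔ u ≤ F x := fun u hu x =>
    ⟨fun h => (hmem u hu).trans (ProbabilityTheory.monotone_cdf ν h), fun h => csInf_le (hbd u hu) h⟩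
  have hmono : MonotoneOn (fun u => sInf (S u)) (Ioo 0 1) := by
    intro u hu v hv huv
    exact (hiff u hu _).2 (huv.trans (hmem v hv))
  have hmeas : AEMeasurable (fun u => sInf (S u)) unitP :=
    aemeasurable_restrict_of_monotoneOn measurableSet_Ioo hmono
  refine ⟨fun u => sInf (S u), hmono, hmeas, ?_, fun u hu x => by rw [aux_cdf]; exact hiff u hu x⟩
  have : IsProbabilityMeasure (unitP.map fun u => sInf (S u)) :=
    Measure.isProbabilityMeasure_map hmeas
  refine Measure.ext_of_Iic _ _ fun x => ?_
  rw [Measure.map_apply_of_aemeasurable hmeas measurableSet_Iic, ← ProbabilityTheory.ofReal_cdf,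
    ← unitP_Iic _ ⟨ProbabilityTheory.cdf_nonneg ν x, ProbabilityTheory.cdf_le_one ν x⟩]
  refine measure_congr ?_
  filter_upwards [ae_unitP] with u hu
  exact propext (hiff u hu x)

lemma aux_winf (μ ν : Measure ℝ) [IsProbabilityMeasure μ] [IsProbabilityMeasure ν] (ε : ℝ)
    (h : Winf μ ν ≤ ENNReal.ofReal ε) (δ : ℝ) (hδ : ε < δ) (hδ0 : 0 < δ) (x : ℝ) :
    cdfM μ (x - δ) ≤ cdfM ν x ∧ cdfM ν x ≤ cdfM μ (x + δ) := by
  have h1 : Winf μ ν < ENNReal.ofReal δ := h.trans_lt ((ENNReal.ofReal_lt_ofReal_iff hδ0).2 hδ)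
  obtain ⟨_, ⟨e, ⟨he, hx⟩, rfl⟩, hlt⟩ := sInf_lt_iff.1 h1
  have hed : e < δ := (ENNReal.ofReal_lt_ofReal_iff hδ0).1 hlt
  have hm : Monotone (cdfM μ) := by
    intro a b hab; rw [aux_cdf, aux_cdf]; exact ProbabilityTheory.monotone_cdf μ hab
  exact ⟨(hm (by linarith)).trans (hx x).1, (hx x).2.trans (hm (by linarith))⟩

lemma aux_call_int (μ : Measure ℝ) (h : MemM μ) (x : ℝ) :
    Integrable (fun y => max (y - x) 0) μ := by
  have := h.1
  exact (h.2.sub (integrable_const x)).pos_part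

lemma aux_cdf_le (S T : Measure ℝ) (hS : MemM S) (hT : MemM T)
    (h : ∀ x, callFn S x = callFn T x) (x k : ℝ) (hk : 0 < k) :
    cdfM S x ≤ cdfM T (x + k) := by
  have := hS.1
  have := hT.1
  have h1 : callFn S x - callFn S (x + k) ≤ k * (1 - cdfM S x) := by
    have : ∀ y, max (y - x) 0 - max (y - (x + k)) 0 ≤ k * (1 - (Iic x).indicator 1 y) := by
      intro y
      by_cases hy : y ≤ x
      · simp [indicator, hy]
      · simp only [indicator, mem_Iic, hy, if_false, sub_zero, mul_one]
        rcases le_total (y - (x + k)) 0 with h | h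
        · rw [max_eq_right h, max_eq_left (by linarith)]; linarith
        · rw [max_eq_left h, max_eq_left (by linarith)]; linarith
    have hi := integral_mono (μ := S) ((aux_call_int S hS x).sub (aux_call_int S hS (x+k)))
      (((integrable_const (1:ℝ)).sub ((integrable_const (1:ℝ)).indicator measurableSet_Iic)).const_mul k) this
    simp only [Pi.sub_apply] at hi
    rw [integral_sub (aux_call_int S hS x) (aux_call_int S hS (x+k)), integral_const_mul, integral_sub (integrable_const (1:ℝ)) ((integrable_const (1:ℝ)).indicator measurableSet_Iic)] at hi
    have e : ∫ y, (Iic x).indicator (fun _ => (1:ℝ)) y ∂S = cdfM S x := by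
      rw [integral_indicator_const _ measurableSet_Iic]; simp [cdfM, Measure.real]
    rw [e] at hi
    simpa [callFn] using hi
  have h2 : k * (1 - cdfM T (x + k)) ≤ callFn T x - callFn T (x + k) := by
    have : ∀ y, k * (1 - (Iic (x + k)).indicator 1 y) ≤ max (y - x) 0 - max (y - (x + k)) 0 := by
      intro y
      by_cases hy : y ≤ x + k
      · simp [indicator, hy]
      · simp only [indicator, mem_Iic, hy, if_false, sub_zero, mul_one]
        push Not at hy
        rw [max_eq_left (by linarith), max_eq_left (by linarith)]; linarith
    have hi := integral_mono (μ := T)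
      (((integrable_const (1:ℝ)).sub ((integrable_const (1:ℝ)).indicator measurableSet_Iic)).const_mul k)
      ((aux_call_int T hT x).sub (aux_call_int T hT (x+k))) this
    simp only [Pi.sub_apply] at hi
    rw [integral_sub (aux_call_int T hT x) (aux_call_int T hT (x+k)), integral_const_mul, integral_sub (integrable_const (1:ℝ)) ((integrable_const (1:ℝ)).indicator measurableSet_Iic)] at hi
    have e : ∫ y, (Iic (x + k)).indicator (fun _ => (1:ℝ)) y ∂T = cdfM T (x + k) := by
      rw [integral_indicator_const _ measurableSet_Iic]; simp [cdfM, Measure.real]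
    rw [e] at hi
    simpa [callFn] using hi
  rw [h, h] at h1
  have := le_of_mul_le_mul_left (h2.trans h1) hk
  linarith

lemma aux_cdf_le' (S T : Measure ℝ) (hS : MemM S) (hT : MemM T)
    (h : ∀ x, callFn S x = callFn T x) (x : ℝ) : cdfM S x ≤ cdfM T x := by
  have := hT.1
  have hrc : Tendsto (ProbabilityTheory.cdf T) (nhdsWithin x (Ioi x)) (nhds (ProbabilityTheory.cdf T x)) :=
    ((ProbabilityTheory.cdf T).right_continuous x).mono_left (nhdsWithin_mono _ Ioi_subset_Ici_self)
  rw [aux_cdf T]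
  refine ge_of_tendsto hrc ?_
  filter_upwards [self_mem_nhdsWithin] with y hy
  have := aux_cdf_le S T hS hT h x (y - x) (sub_pos.2 hy)
  rw [aux_cdf T] at this
  simpa using this

lemma aux_unique (S T : Measure ℝ) (hS : MemM S) (hT : MemM T)
    (h : ∀ x, callFn S x = callFn T x) : S = T := by
  have := hS.1
  have := hT.1
  refine Measure.ext_of_Iic _ _ fun x => ?_
  have := le_antisymm (aux_cdf_le' S T hS hT h x) (aux_cdf_le' T S hT hS (fun x => (h x).symm) x)
  exact (ENNReal.toReal_eq_toReal_iff' (measure_ne_top _ _) (measure_ne_top _ _)).1 this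

/-- existence and uniqueness of the greatest element `T(μ; m, ε)` of
`B∞(μ,ε) ∩ M_m` in convex order, with call function `R^max_μ(·; m, ε)`. -/
theorem ball_winf_greatest_element (ε : ℝ) (hε : 0 < ε) (μ : Measure ℝ) (hμ : MemM μ)
    (m : ℝ) (hm : m ∈ Set.Icc (meanM μ - ε) (meanM μ + ε)) :
    ∃! T : Measure ℝ,
      (InBallWinf μ ε T ∧ meanM T = m) ∧
      (∀ ν : Measure ℝ, InBallWinf μ ε ν → meanM ν = m → ConvexOrder ν T) ∧
      (∀ x : ℝ, callFn T x
        = conv2 (fun y => m + callFn μ (y + ε) - (meanM μ - ε))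
            (fun y => callFn μ (y - ε)) x) := by
  have := hμ.1
  obtain ⟨X, hXmono, hXmeas, hXmap, hXiff⟩ := aux_quantile μ
  -- integrals against `μ` as integrals over the unit interval
  have hXint : Integrable X unitP := by
    have := hμ.2; rw [← hXmap] at this
    exact this.comp_aemeasurable hXmeas
  have hE : meanM μ = ∫ u, X u ∂unitP := by
    unfold meanM; conv_lhs => rw [← hXmap]
    exact integral_map hXmeas (by fun_prop)
  have hcall : ∀ x, callFn μ x = ∫ u, max (X u - x) 0 ∂unitP := by
    intro x
    unfold callFn; conv_lhs => rw [← hXmap]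
    exact integral_map hXmeas (by fun_prop)
  set p : ℝ := (1 - (m - meanM μ) / ε) / 2 with hp
  have hpmem : p ∈ Icc (0 : ℝ) 1 := by
    have h1 : (m - meanM μ) / ε ≤ 1 := by rw [div_le_one hε]; linarith [hm.2]
    have h2 : -1 ≤ (m - meanM μ) / ε := by rw [le_div_iff₀ hε]; linarith [hm.1]
    constructor <;> rw [hp] <;> linarith
  have hpe : ε * (1 - 2 * p) = m - meanM μ := by rw [hp]; field_simp; ring
  set σ : ℝ → ℝ := fun u => ε - (2 * ε) * (Iic p).indicator (fun _ => (1 : ℝ)) u with hσ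
  have hσ1 : ∀ u, u ≤ p → σ u = -ε := by intro u hu; simp [hσ, hu]; ring
  have hσ2 : ∀ u, p < u → σ u = ε := by intro u hu; simp [hσ, not_le.2 hu]
  have hσb : ∀ u, -ε ≤ σ u ∧ σ u ≤ ε := by
    intro u
    rcases le_or_gt u p with h | h
    · rw [hσ1 u h]; constructor <;> linarith
    · rw [hσ2 u h]; constructor <;> linarith
  have hind : Integrable (fun u => (Iic p).indicator (fun _ => (1 : ℝ)) u) unitP :=
    (integrable_const (1:ℝ)).indicator measurableSet_Iic
  have hσint : Integrable σ unitP := (integrable_const ε).sub (hind.const_mul (2 * ε))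
  have hσI : ∫ u, σ u ∂unitP = m - meanM μ := by
    rw [hσ, integral_sub (integrable_const ε) (hind.const_mul (2 * ε)), integral_const_mul,
      integral_indicator_const _ measurableSet_Iic, ← hpe]
    simp only [Measure.real, unitP_Iic p hpmem, ENNReal.toReal_ofReal hpmem.1]
    simp; ring
  set Z : ℝ → ℝ := fun u => X u + σ u with hZ
  have hZint : Integrable Z unitP := hXint.add hσint
  have hZmeas : AEMeasurable Z unitP := hZint.aemeasurable
  have hZI : ∫ u, Z u ∂unitP = m := by
    rw [hZ, integral_add hXint hσint, hσI, ← hE]; ring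
  have hXc : ∀ x, Integrable (fun u => max (X u - x) 0) unitP := fun x =>
    (hXint.sub (integrable_const x)).pos_part
  have hZc : ∀ x, Integrable (fun u => max (Z u - x) 0) unitP := fun x =>
    (hZint.sub (integrable_const x)).pos_part
  set T : Measure ℝ := unitP.map Z with hT
  have hTM : MemM T := by
    refine ⟨Measure.isProbabilityMeasure_map hZmeas, ?_⟩
    rw [hT, integrable_map_measure (by fun_prop) hZmeas]
    exact hZint
  have := hTM.1
  have hTm : meanM T = m := by
    rw [← hZI]; exact integral_map hZmeas (by fun_prop)
  have hTcall : ∀ x, callFn T x = ∫ u, max (Z u - x) 0 ∂unitP := fun x =>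
    integral_map hZmeas (by fun_prop)
  have hcdf : ∀ x, cdfM T x = (unitP (Z ⁻¹' Iic x)).toReal := by
    intro x; rw [cdfM, hT, Measure.map_apply_of_aemeasurable hZmeas measurableSet_Iic]
  have hcdfμ : ∀ x, cdfM μ x = (unitP (X ⁻¹' Iic x)).toReal := by
    intro x; rw [cdfM]; conv_lhs => rw [← hXmap]
    rw [Measure.map_apply_of_aemeasurable hXmeas measurableSet_Iic]
  have hTW : Winf μ T ≤ ENNReal.ofReal ε := by
    refine sInf_le ⟨ε, ⟨hε, fun x => ?_⟩, rfl⟩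
    rw [hcdf, hcdfμ, hcdfμ]
    constructor
    · refine ENNReal.toReal_mono (measure_ne_top _ _) (measure_mono fun u hu => ?_)
      have h1 : X u ≤ x - ε := hu
      show X u + σ u ≤ x
      linarith [(hσb u).2]
    · refine ENNReal.toReal_mono (measure_ne_top _ _) (measure_mono fun u hu => ?_)
      have h1 : X u + σ u ≤ x := hu
      show X u ≤ x + ε
      linarith [(hσb u).1]
  have hg : ∀ x, callFn μ (x - ε) = ∫ u, max (X u - (x - ε)) 0 ∂unitP := fun x => hcall _
  have hf : ∀ x, m + callFn μ (x + ε) - (meanM μ - ε)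
      = ∫ u, (max (X u - (x + ε)) 0 + (σ u + ε)) ∂unitP := by
    intro x
    have hse : Integrable (fun u => σ u + ε) unitP := hσint.add (integrable_const ε)
    rw [integral_add (hXc _) hse, integral_add hσint (integrable_const ε), hσI,
      hcall]
    simp; ring
  have hfint : ∀ x, Integrable (fun u => max (X u - (x + ε)) 0 + (σ u + ε)) unitP := fun x =>
    (hXc _).add (hσint.add (integrable_const ε))
  have hlef : ∀ x, callFn T x ≤ m + callFn μ (x + ε) - (meanM μ - ε) := by
    intro x
    rw [hf, hTcall]
    refine integral_mono (hZc x) (hfint x) fun u => ?_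
    have h1 := hσb u
    have h2 := le_max_left (X u - (x + ε)) 0
    have h3 := le_max_right (X u - (x + ε)) 0
    apply max_le
    · simp only [hZ]; linarith
    · linarith
  have hleg : ∀ x, callFn T x ≤ callFn μ (x - ε) := by
    intro x
    rw [hg, hTcall]
    refine integral_mono (hZc x) (hXc _) fun u => ?_
    have h1 := hσb u
    apply max_le_max _ le_rfl
    simp only [hZ]; linarith
  have hconv : ConvexOn ℝ Set.univ (callFn T) := by
    refine ⟨convex_univ, fun a _ b _ s t hs ht hst => ?_⟩
    rw [hTcall, hTcall, hTcall, smul_eq_mul, smul_eq_mul, smul_eq_mul, smul_eq_mul, ← integral_const_mul, ← integral_const_mul,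
      ← integral_add ((hZc a).const_mul s) ((hZc b).const_mul t)]
    refine integral_mono (hZc _) (((hZc a).const_mul s).add ((hZc b).const_mul t)) fun u => ?_
    have h1 := mul_le_mul_of_nonneg_left (le_max_left (Z u - a) 0) hs
    have h2 := mul_le_mul_of_nonneg_left (le_max_left (Z u - b) 0) ht
    have h3 := mul_nonneg hs (le_max_right (Z u - a) 0)
    have h4 := mul_nonneg ht (le_max_right (Z u - b) 0)
    apply max_le
    · have : Z u = s * Z u + t * Z u := by rw [← add_mul, hst, one_mul]
      simp only [Pi.add_apply]
      linarith
    · simp only [Pi.add_apply]; linarith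
  -- maximality of the call function among convex minorants
  have hmax : ∀ h : ℝ → ℝ, ConvexOn ℝ Set.univ h →
      (∀ y, h y ≤ min (m + callFn μ (y + ε) - (meanM μ - ε)) (callFn μ (y - ε))) →
      ∀ x, h x ≤ callFn T x := by
    intro h hh hle x
    have hl1 := fun y => (hle y).trans (min_le_left _ _)
    have hl2 := fun y => (hle y).trans (min_le_right _ _)
    rcases hpmem.1.eq_or_lt with hp0 | hp0
    · refine (hl2 x).trans (le_of_eq ?_)
      rw [hg, hTcall]
      refine integral_congr_ae ?_
      filter_upwards [ae_unitP] with u hu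
      have : σ u = ε := hσ2 u (by rw [← hp0]; exact hu.1)
      simp only [hZ, this]; congr 1; ring
    rcases hpmem.2.eq_or_lt with hp1 | hp1
    · refine (hl1 x).trans (le_of_eq ?_)
      rw [hf, hTcall]
      refine integral_congr_ae ?_
      filter_upwards [ae_unitP] with u hu
      have : σ u = -ε := hσ1 u (by rw [hp1]; exact hu.2.le)
      simp only [hZ, this]
      rw [neg_add_cancel, add_zero]; congr 1; ring
    have hpI : p ∈ Ioo (0 : ℝ) 1 := ⟨hp0, hp1⟩
    set c := X p with hc
    have hR : ∀ x, c + ε ≤ x → callFn T x = callFn μ (x - ε) := by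
      intro x hx
      rw [hg, hTcall]
      refine integral_congr_ae ?_
      filter_upwards [ae_unitP] with u hu
      rcases le_or_gt u p with hup | hup
      · have hX := hXmono hu hpI hup
        simp only [hZ, hσ1 u hup]
        rw [max_eq_right (by linarith), max_eq_right (by linarith)]
      · simp only [hZ, hσ2 u hup]; congr 1; ring
    have hL : ∀ x, x ≤ c - ε → callFn T x = m + callFn μ (x + ε) - (meanM μ - ε) := by
      intro x hx
      rw [hf, hTcall]
      refine integral_congr_ae ?_
      filter_upwards [ae_unitP] with u hu
      rcases le_or_gt u p with hup | hup
      · simp only [hZ, hσ1 u hup]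
        rw [neg_add_cancel, add_zero]; congr 1; ring
      · have hX := hXmono hpI hu hup.le
        simp only [hZ, hσ2 u hup]
        rw [max_eq_left (by linarith), max_eq_left (by linarith)]; ring
    rcases le_total x (c - ε) with hx | hx
    · rw [hL x hx]; exact hl1 x
    rcases le_total (c + ε) x with hx' | hx'
    · rw [hR x hx']; exact hl2 x
    obtain ⟨s, t, hs, ht, hst, hxe⟩ : ∃ s t : ℝ, 0 ≤ s ∧ 0 ≤ t ∧ s + t = 1 ∧
        s * (c - ε) + t * (c + ε) = x := by
      refine ⟨(c + ε - x) / (2 * ε), (x - (c - ε)) / (2 * ε), ?_, ?_, ?_, ?_⟩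
      · apply div_nonneg <;> linarith
      · apply div_nonneg <;> linarith
      · field_simp; ring
      · field_simp; ring
    have h1 : h x ≤ s * h (c - ε) + t * h (c + ε) := by
      have := hh.2 (mem_univ (c - ε)) (mem_univ (c + ε)) hs ht hst
      simp only [smul_eq_mul] at this
      rwa [hxe] at this
    have h2 : callFn T x = s * callFn T (c - ε) + t * callFn T (c + ε) := by
      rw [hTcall, hTcall, hTcall, ← integral_const_mul, ← integral_const_mul,
        ← integral_add ((hZc _).const_mul s) ((hZc _).const_mul t)]
      refine integral_congr_ae ?_
      filter_upwards [ae_unitP] with u hu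
      rcases le_or_gt u p with hup | hup
      · have hX := hXmono hu hpI hup
        simp only [hZ, hσ1 u hup]
        rw [max_eq_right (by linarith), max_eq_right (by linarith), max_eq_right (by linarith)]
        simp
      · have hX := hXmono hpI hu hup.le
        simp only [hZ, hσ2 u hup]
        rw [max_eq_left (by linarith), max_eq_left (by linarith), max_eq_left (by linarith), ← hxe]
        have : s = 1 - t := by linarith
        subst this; ring
    have h3 := mul_le_mul_of_nonneg_left (hl1 (c - ε)) hs
    have h4 := mul_le_mul_of_nonneg_left (hl2 (c + ε)) ht
    rw [← hL _ le_rfl] at h3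
    rw [← hR _ le_rfl] at h4
    linarith
  have hTconv : ∀ x : ℝ, callFn T x
        = conv2 (fun y => m + callFn μ (y + ε) - (meanM μ - ε))
            (fun y => callFn μ (y - ε)) x := by
    intro x
    symm
    refine IsGreatest.csSup_eq ⟨⟨callFn T, hconv, fun y => le_min (hlef y) (hleg y), rfl⟩, ?_⟩
    rintro _ ⟨h, hh, hle, rfl⟩
    exact hmax h hh hle x
  refine ⟨T, ⟨⟨⟨hTM, hTW⟩, hTm⟩, ?_, hTconv⟩, ?_⟩
  · intro ν hν hνm φ hφ hφν hφT
    have := hν.1.1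
    obtain ⟨Y, hYmono, hYmeas, hYmap, hYiff⟩ := aux_quantile ν
    have hφc : Continuous φ := continuousOn_univ.1 (hφ.continuousOn isOpen_univ)
    have hYint : Integrable Y unitP := by
      have := hν.1.2; rw [← hYmap] at this
      exact this.comp_aemeasurable hYmeas
    have hYI : ∫ u, Y u ∂unitP = m := by
      rw [← hνm]
      symm
      unfold meanM; conv_lhs => rw [← hYmap]
      exact integral_map hYmeas (by fun_prop)
    have hφY : Integrable (fun u => φ (Y u)) unitP := by
      have := hφν; rw [← hYmap] at this
      exact this.comp_aemeasurable hYmeas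
    have hφZ : Integrable (fun u => φ (Z u)) unitP := hφT.comp_aemeasurable hZmeas
    have e1 : ∫ y, φ y ∂ν = ∫ u, φ (Y u) ∂unitP := by
      conv_lhs => rw [← hYmap]
      exact integral_map hYmeas hφc.aestronglyMeasurable
    have e2 : ∫ y, φ y ∂T = ∫ u, φ (Z u) ∂unitP := integral_map hZmeas hφc.aestronglyMeasurable
    have hXY : ∀ u ∈ Ioo (0 : ℝ) 1, Y u ≤ X u + ε ∧ X u - ε ≤ Y u := by
      intro u hu
      have key : ∀ δ, ε < δ → Y u ≤ X u + δ ∧ X u ≤ Y u + δ := by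
        intro δ hδ
        have hw := aux_winf μ ν ε hν.2 δ hδ (hε.trans hδ)
        constructor
        · refine (hYiff u hu _).2 (((hXiff u hu _).1 le_rfl).trans ?_)
          simpa using (hw (X u + δ)).1
        · exact (hXiff u hu _).2 (((hYiff u hu _).1 le_rfl).trans (hw (Y u)).2)
      constructor
      · have : Y u - X u ≤ ε := le_of_forall_gt_imp_ge_of_dense fun δ hδ => by
          linarith [(key δ hδ).1]
        linarith
      · have : X u - Y u ≤ ε := le_of_forall_gt_imp_ge_of_dense fun δ hδ => by
          linarith [(key δ hδ).2]
        linarith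
    have hlow : ∀ u ∈ Ioo (0 : ℝ) 1, u ≤ p → Z u ≤ Y u := by
      intro u hu hup
      simp only [hZ, hσ1 u hup]; linarith [(hXY u hu).2]
    have hhigh : ∀ u ∈ Ioo (0 : ℝ) 1, p < u → Y u ≤ Z u := by
      intro u hu hup
      simp only [hZ, hσ2 u hup]; linarith [(hXY u hu).1]
    rw [e1, e2]
    rcases hpmem.1.eq_or_lt with hp0 | hp0
    · have hle : Y ≤ᵐ[unitP] Z := by
        filter_upwards [ae_unitP] with u hu
        exact hhigh u hu (by rw [← hp0]; exact hu.1)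
      have heq := (integral_eq_iff_of_ae_le hYint hZint hle).1 (hYI.trans hZI.symm)
      refine le_of_eq (integral_congr_ae ?_)
      filter_upwards [heq] with u hu
      rw [hu]
    rcases hpmem.2.eq_or_lt with hp1 | hp1
    · have hle : Z ≤ᵐ[unitP] Y := by
        filter_upwards [ae_unitP] with u hu
        exact hlow u hu (by rw [hp1]; exact hu.2.le)
      have heq := (integral_eq_iff_of_ae_le hZint hYint hle).1 (hZI.trans hYI.symm)
      refine le_of_eq (integral_congr_ae ?_)
      filter_upwards [heq] with u hu
      rw [hu]
    have hpI : p ∈ Ioo (0 : ℝ) 1 := ⟨hp0, hp1⟩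
    obtain ⟨s, hs1, hs2⟩ := aux_subgrad φ hφ (Y p)
    have hmono : ∫ u, s * (Z u - Y u) ∂unitP ≤ ∫ u, (φ (Z u) - φ (Y u)) ∂unitP := by
      refine integral_mono_ae ((hZint.sub hYint).const_mul s) (hφZ.sub hφY) ?_
      filter_upwards [ae_unitP] with u hu
      rcases le_or_gt u p with hup | hup
      · exact hs1 _ _ (hlow u hu hup) (hYmono hu hpI hup)
      · exact hs2 _ _ (hYmono hpI hu hup.le) (hhigh u hu hup)
    rw [integral_const_mul, integral_sub hZint hYint, hZI, hYI, integral_sub hφZ hφY] at hmono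
    linarith
  · rintro S ⟨⟨⟨hSM, _⟩, _⟩, _, hSc⟩
    exact aux_unique S T hSM hTM fun x => by rw [hSc, hTconv]
end
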